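/- Let X be a finitely irreducible countable Markov shift, φ: X → ℝ measurable with Gibbs state μ_φ. Let l ≥ 1, let φ_1,…,φ_l be bounded uniformly continuous real functions on X and α_1,…,α_l ∈ ℝ, and write V̄{φ_j,α_j} = {μ ∈ M : ∫φ_j dμ ≥ α_j for j = 1,…,l} and V{φ_j,α_j-ε} = {μ ∈ M : ∫φ_j dμ > α_j - ε for j = 1,…,l}. Then for every ε > 0, limsup_{n→∞} (1/n) log ξ_n( V̄{φ_j,α_j} ) ≤ sup{ F(μ) : μ ∈ V{φ_j,α_j-ε} }. If moreover X is finitely primitive, the same conclusion holds with ξ_n replaced by η_n, η_{a,n}, ζ_{y,n} and ζ_{a,y,n} for any a ∈ S and y ∈ X. -/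

import Mathlib

open MeasureTheory Filter Topology Set
open scoped ENNReal NNReal

namespace CMS

/-! ### Generic dynamical notions -/

variable {X : Type*}

/-- Birkhoff sum `S_n φ`. -/
noncomputable def birkhoff (T : X → X) (φ : X → ℝ) (n : ℕ) (x : X) : ℝ :=
  ∑ i ∈ Finset.range n, φ (T^[i] x)

/-- A measure is invariant under `T`. -/
def Invariant [MeasurableSpace X] (T : X → X) (μ : Measure X) : Prop :=
  Measure.map T μ = μ

/-- `∫ φ dμ > -∞`, i.e. the negative part of `φ` is integrable. -/
def IntegralGtBot [MeasurableSpace X] (φ : X → ℝ) (μ : Measure X) : Prop :=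
  (∫⁻ x, ENNReal.ofReal (-φ x) ∂μ) ≠ ⊤

/-- The integral of `φ`, with values in `EReal` (defined whenever one of the parts is finite). -/
noncomputable def eintegral [MeasurableSpace X] (φ : X → ℝ) (μ : Measure X) : EReal :=
  ((∫⁻ x, ENNReal.ofReal (φ x) ∂μ : ℝ≥0∞) : EReal) -
    ((∫⁻ x, ENNReal.ofReal (-φ x) ∂μ : ℝ≥0∞) : EReal)

/-- Entropy of the countable partition induced by a map `g` with countable range. -/
noncomputable def partitionEntropy [MeasurableSpace X] {α : Type*} (μ : Measure X) (g : X → α) :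
    ℝ≥0∞ :=
  ∑' a : α, ENNReal.ofReal (-((μ (g ⁻¹' {a})).toReal * Real.log ((μ (g ⁻¹' {a})).toReal)))

/-- Kolmogorov–Sinaĭ entropy of `T` with respect to `μ`: the supremum over finite measurable
partitions (coded by maps `X → ℕ` with finite range) of the asymptotic entropy of iterated
joins of the partition. -/
noncomputable def entropy [MeasurableSpace X] (T : X → X) (μ : Measure X) : ℝ≥0∞ :=
  ⨆ (p : X → ℕ) (_ : Measurable p ∧ (Set.range p).Finite),
    atTop.liminf fun n : ℕ =>
      ENNReal.ofReal ((n : ℝ)⁻¹) * partitionEntropy μ (fun x => fun i : Fin n => p (T^[i] x))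

/-- The empirical measure `δ_x^n = (1/n) ∑_{i<n} δ_{T^i x}` (with junk convention `n = 0 ↦ n = 1`,
irrelevant since only `n ≥ 1` is ever used). -/
noncomputable def empirical [MeasurableSpace X] (T : X → X) (x : X) (n : ℕ) :
    ProbabilityMeasure X :=
  ⟨((max n 1 : ℕ) : ℝ≥0∞)⁻¹ • ∑ i ∈ Finset.range (max n 1), Measure.dirac (T^[i] x), by
    refine ⟨?_⟩
    have h1 : (∑ i ∈ Finset.range (max n 1), Measure.dirac (T^[i] x)) Set.univ
        = ((max n 1 : ℕ) : ℝ≥0∞) := by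
      rw [Measure.finset_sum_apply]
      simp
    rw [Measure.smul_apply, h1, smul_eq_mul, ENNReal.inv_mul_cancel] <;> simp⟩

noncomputable instance [MeasurableSpace X] [TopologicalSpace X] [OpensMeasurableSpace X] :
    MeasurableSpace (ProbabilityMeasure X) := borel _

/-- Sets of periodic points. -/
def perSet (T : X → X) (n : ℕ) : Set X := {x | T^[n] x = x}

/-- Sets of iterated preimages of a point. -/
def preimSet (T : X → X) (n : ℕ) (y : X) : Set X := {x | T^[n] x = y}

/-- The partition function `Z_n(φ, C)` over a subset `C`. -/
noncomputable def Zfn [MeasurableSpace X] (T : X → X) (φ : X → ℝ) (n : ℕ) (C : Set X) : ℝ≥0∞ :=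
  ∑' x : C, ENNReal.ofReal (Real.exp (birkhoff T φ n x))

/-- The distribution of the empirical measures under `μ`. -/
noncomputable def empDistr [MeasurableSpace X] [TopologicalSpace X] [OpensMeasurableSpace X]
    (T : X → X) (μ : Measure X) (n : ℕ) : Measure (ProbabilityMeasure X) :=
  Measure.map (fun x => empirical T x n) μ

/-- The distribution `Z_n(φ,C)⁻¹ ∑_{x ∈ C} e^{S_nφ(x)} δ_{δ_x^n}` on the space of probability
measures, for a countable set `C` (of weighted periodic points or iterated preimages). -/
noncomputable def weightedDistr [MeasurableSpace X] [TopologicalSpace X] [OpensMeasurableSpace X]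
    (T : X → X) (φ : X → ℝ) (n : ℕ) (C : Set X) : Measure (ProbabilityMeasure X) :=
  (Zfn T φ n C)⁻¹ •
    Measure.sum (fun x : C =>
      ENNReal.ofReal (Real.exp (birkhoff T φ n x)) • Measure.dirac (empirical T (x : X) n))

/-! ### Large deviations notions -/

variable {Y : Type*}

/-- The large deviation principle for a sequence of (sub)probability measures with rate
function `J`. -/
def HasLDP [TopologicalSpace Y] [MeasurableSpace Y] (μ : ℕ → Measure Y) (J : Y → EReal) : Prop :=
  (∀ G : Set Y, IsOpen G →
      -(⨅ y ∈ G, J y) ≤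
        atTop.liminf fun n : ℕ => (((n : ℝ)⁻¹ : ℝ) : EReal) * ENNReal.log (μ n G)) ∧
  (∀ K : Set Y, IsClosed K →
      atTop.limsup (fun n : ℕ => (((n : ℝ)⁻¹ : ℝ) : EReal) * ENNReal.log (μ n K)) ≤
        -(⨅ y ∈ K, J y))

/-- Exponential tightness of a sequence of measures. -/
def ExpTight [TopologicalSpace Y] [MeasurableSpace Y] (μ : ℕ → Measure Y) : Prop :=
  ∀ L : ℝ, 0 < L → ∃ K : Set Y, IsCompact K ∧
    atTop.limsup (fun n : ℕ => (((n : ℝ)⁻¹ : ℝ) : EReal) * ENNReal.log (μ n Kᶜ)) ≤ ((-L : ℝ) : EReal)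

/-- A good rate function: lower semicontinuous with compact sublevel sets. -/
def GoodRate [TopologicalSpace Y] (J : Y → EReal) : Prop :=
  LowerSemicontinuous J ∧ ∀ α : ℝ, 0 ≤ α → IsCompact {y | J y ≤ (α : EReal)}

/-- The rate function `I(μ) = - inf_{G ∋ μ} sup_G F`. -/
noncomputable def rateOf [TopologicalSpace Y] (F : Y → EReal) (μ : Y) : EReal :=
  -(⨅ (G : Set Y) (_ : IsOpen G ∧ μ ∈ G), ⨆ ν ∈ G, F ν)

/-- The convex combination `t μ + (1-t) ν` of two probability measures. -/
noncomputable def mix [MeasurableSpace X] (t : ℝ) (h0 : 0 ≤ t) (h1 : t ≤ 1)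
    (μ ν : ProbabilityMeasure X) : ProbabilityMeasure X :=
  ⟨ENNReal.ofReal t • (μ : Measure X) + ENNReal.ofReal (1 - t) • (ν : Measure X), by
    refine ⟨?_⟩
    simp only [Measure.add_apply, Measure.smul_apply, smul_eq_mul, measure_univ, mul_one]
    rw [← ENNReal.ofReal_add h0 (by linarith)]
    norm_num⟩

/-- Convexity of a rate function on probability measures. -/
def ConvexRate [MeasurableSpace X] (J : ProbabilityMeasure X → EReal) : Prop :=
  ∀ μ ν : ProbabilityMeasure X, ∀ t : ℝ, ∀ (h0 : 0 ≤ t) (h1 : t ≤ 1),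
    J (mix t h0 h1 μ ν) ≤ ((t : ℝ) : EReal) * J μ + ((1 - t : ℝ) : EReal) * J ν

-- The free energy functional `F`.
open Classical in
noncomputable def freeEnergy [MeasurableSpace X] (T : X → X) (φ : X → ℝ) (P : ℝ)
    (ν : ProbabilityMeasure X) : EReal :=
  if Invariant T (ν : Measure X) ∧ IntegralGtBot φ (ν : Measure X)
  then ((entropy T (ν : Measure X) : ℝ≥0∞) : EReal) + eintegral φ (ν : Measure X) - ((P : ℝ) : EReal)
  else ⊥

/-! ### Countable Markov shifts -/

variable {S : Type*}

/-- The topological Markov shift with alphabet `S` and transition relation `A`. -/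
def Space (A : S → S → Prop) : Type _ := {x : ℕ → S // ∀ i, A (x i) (x (i + 1))}

variable (A : S → S → Prop)

instance [TopologicalSpace S] : TopologicalSpace (Space A) :=
  inferInstanceAs (TopologicalSpace {x : ℕ → S // ∀ i, A (x i) (x (i + 1))})

noncomputable instance [TopologicalSpace S] : MeasurableSpace (Space A) := borel _

instance [TopologicalSpace S] : BorelSpace (Space A) := ⟨rfl⟩

/-- The left shift. -/
def shift : Space A → Space A := fun x => ⟨fun i => x.1 (i + 1), fun i => x.2 (i + 1)⟩

/-- Admissible words. -/
def Admissible (w : List S) : Prop := w ≠ [] ∧ w.Chain' A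

/-- The cylinder set of a word. -/
def cylinder (w : List S) : Set (Space A) := {x | ∀ i : Fin w.length, x.1 i = w.get i}

variable {A}

/-- The initial word of length `n` of a point. -/
def word (x : Space A) (n : ℕ) : List S := List.ofFn (fun i : Fin n => x.1 i)

variable (A)

/-- `μ` is a Gibbs state for the potential `φ` with constants `c₀` and `P`. -/
def IsGibbsWith [TopologicalSpace S] (φ : Space A → ℝ) (μ : Measure (Space A)) (c₀ P : ℝ) :
    Prop :=
  ∀ n : ℕ, 1 ≤ n → ∀ x : Space A,
    c₀⁻¹ * Real.exp (-(P * n) + birkhoff (shift A) φ n x)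
        ≤ (μ (cylinder A (word x n))).toReal ∧
      (μ (cylinder A (word x n))).toReal
        ≤ c₀ * Real.exp (-(P * n) + birkhoff (shift A) φ n x)

/-- `μ` is a Gibbs state for `φ`. -/
def IsGibbs [TopologicalSpace S] (φ : Space A → ℝ) (μ : Measure (Space A)) : Prop :=
  ∃ c₀ P : ℝ, 1 ≤ c₀ ∧ IsGibbsWith A φ μ c₀ P

/-- The transition matrix has no row or column identically zero. -/
def NoZeroRowCol : Prop := (∀ a : S, ∃ b, A a b) ∧ ∀ b : S, ∃ a, A a b

/-- Finite irreducibility. -/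
def FinitelyIrreducible : Prop :=
  ∃ Λ : Finset (List S), ∀ v w : List S, Admissible A v → Admissible A w →
    ∃ l ∈ Λ, Admissible A (v ++ l ++ w)

/-- Finite primitiveness. -/
def FinitelyPrimitive : Prop :=
  ∃ Λ : Finset (List S), (∃ N : ℕ, ∀ l ∈ Λ, l.length = N) ∧
    ∀ v w : List S, Admissible A v → Admissible A w →
      ∃ l ∈ Λ, Admissible A (v ++ l ++ w)

/-- Topological transitivity. -/
def TopTransitive : Prop :=
  ∀ a b : S, ∃ n : ℕ, 1 ≤ n ∧
    (cylinder A [a] ∩ (shift A)^[n] ⁻¹' (cylinder A [b])).Nonempty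

/-- Varadhan's functional `Q(ψ) = sup_μ (∫ψ dμ - I(μ))`. -/
noncomputable def varQ {X : Type*} [MeasurableSpace X] (I : ProbabilityMeasure X → EReal)
    (ψ : X → ℝ) : EReal :=
  ⨆ μ : ProbabilityMeasure X, (((∫ x, ψ x ∂(μ : Measure X)) : ℝ) : EReal) - I μ

/-- `φ` is uniformly continuous for the standard metric of the shift space. -/
def UnifCont (φ : Space A → ℝ) : Prop :=
  ∀ ε : ℝ, 0 < ε → ∃ N : ℕ, ∀ x y : Space A, (∀ i < N, x.1 i = y.1 i) → |φ x - φ y| ≤ ε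

/-- `φ` is bounded. -/
def Bdd (φ : Space A → ℝ) : Prop := ∃ C : ℝ, ∀ x : Space A, |φ x| ≤ C

end CMS

namespace CMS

/-! ### Towers over Bernoulli measures -/

section Tower

theorem iterate_mul_of_factor {X ι : Type*} {T : X → X} {m : ℕ} {π : (ℕ → ι) → X}
    (hfac : ∀ ω, T^[m] (π ω) = π (fun j => ω (j + 1))) (j : ℕ)
    (ω : ℕ → ι) : T^[m * j] (π ω) = π (fun i => ω (i + j)) := by
  induction j generalizing ω with
  | zero => simp
  | succ j ih =>
    rw [Nat.mul_succ, Function.iterate_add_apply, hfac, ih]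
    simp [add_assoc]

variable {X ι : Type*} [MeasurableSpace X] [MeasurableSpace ι]

/-- The Bernoulli measure on one-sided sequences with marginal `ρ`. -/
noncomputable def bernoulli (ρ : Measure ι) [IsProbabilityMeasure ρ] : Measure (ℕ → ι) :=
  Measure.infinitePi fun _ => ρ

instance (ρ : Measure ι) [IsProbabilityMeasure ρ] : IsProbabilityMeasure (bernoulli ρ) :=
  inferInstanceAs (IsProbabilityMeasure (Measure.infinitePi _))

theorem map_shift_bernoulli (ρ : Measure ι) [IsProbabilityMeasure ρ] :
    (bernoulli ρ).map (fun ω j => ω (j + 1)) = bernoulli ρ := by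
  refine Measure.eq_infinitePi _ fun s t ht => ?_
  have hm : Measurable fun (ω : ℕ → ι) j => ω (j + 1) := by fun_prop
  rw [Measure.map_apply hm (.pi s.countable_toSet fun _ _ => ht _)]
  have : (fun (ω : ℕ → ι) j => ω (j + 1)) ⁻¹' (Set.pi s t)
      = Set.pi (s.map (addRightEmbedding 1) : Finset ℕ) (fun i => t (i - 1)) := by
    ext ω; simp
  rw [this, bernoulli, Measure.infinitePi_pi _ (fun i _ => ht _)]
  simp

/-- The measure averaging, over `m` successive times, the image under `π` of a Bernoulli
measure. -/
noncomputable def tower (T : X → X) (m : ℕ) (π : (ℕ → ι) → X) (ρ : Measure ι)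
    [IsProbabilityMeasure ρ] : Measure X :=
  (m : ℝ≥0∞)⁻¹ • ∑ i ∈ Finset.range m, (bernoulli ρ).map (fun ω => T^[i] (π ω))

variable {T : X → X} {m : ℕ} {π : (ℕ → ι) → X} (ρ : Measure ι) [IsProbabilityMeasure ρ]

theorem isProbabilityMeasure_tower (hT : Measurable T) (hπ : Measurable π) (hm : 0 < m) :
    IsProbabilityMeasure (tower T m π ρ) := by
  refine ⟨?_⟩
  have h : ∀ i, ((bernoulli ρ).map (fun ω => T^[i] (π ω))) univ = 1 := fun i => by
    have : Measurable fun ω => T^[i] (π ω) := (hT.iterate i).comp hπ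
    simp [Measure.map_apply this MeasurableSet.univ]
  rw [tower, Measure.smul_apply, Measure.finsetSum_apply]
  simp only [h, Finset.sum_const, Finset.card_range, nsmul_eq_mul, mul_one, smul_eq_mul]
  exact ENNReal.inv_mul_cancel (by exact_mod_cast hm.ne') (by simp)

theorem invariant_tower (hT : Measurable T) (hπ : Measurable π)
    (hfac : ∀ ω, T^[m] (π ω) = π (fun j => ω (j + 1))) : Invariant T (tower T m π ρ) := by
  have h1 : ∀ i, Measure.map T ((bernoulli ρ).map (fun ω => T^[i] (π ω)))
      = (bernoulli ρ).map (fun ω => T^[i + 1] (π ω)) := fun i => by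
    have : Measurable fun ω => T^[i] (π ω) := (hT.iterate i).comp hπ
    rw [Measure.map_map hT this]
    congr 1
    funext ω
    simp [Function.iterate_succ_apply']
  have h2 : (bernoulli ρ).map (fun ω => T^[m] (π ω)) = (bernoulli ρ).map (fun ω => T^[0] (π ω)) := by
    simp only [hfac, Function.iterate_zero, id_eq]
    conv_rhs => rw [← map_shift_bernoulli ρ]
    rw [Measure.map_map hπ (by fun_prop)]
    rfl
  rw [Invariant, tower, Measure.map_smul]
  congr 1
  have h3 : Measure.map T (∑ i ∈ Finset.range m, (bernoulli ρ).map (fun ω => T^[i] (π ω)))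
      = ∑ i ∈ Finset.range m, (bernoulli ρ).map (fun ω => T^[i + 1] (π ω)) := by
    simp_rw [← h1]
    ext s hs
    simp [Measure.map_apply hT hs, Measure.finsetSum_apply]
  rw [h3]
  cases m with
  | zero => simp
  | succ k =>
    rw [Finset.sum_range_succ, h2, Finset.sum_range_succ' (fun i =>
      (bernoulli ρ).map (fun ω => T^[i] (π ω)))]

theorem integral_tower (hT : Measurable T) (hπ : Measurable π) {ψ : X → ℝ} (hψ : Measurable ψ)
    {C : ℝ} (hC : ∀ i ω, |ψ (T^[i] (π ω))| ≤ C) :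
    Integrable ψ (tower T m π ρ) ∧
      ∫ x, ψ x ∂(tower T m π ρ) = (m : ℝ)⁻¹ * ∫ ω, birkhoff T ψ m (π ω) ∂(bernoulli ρ) := by
  have hTi : ∀ i, Measurable fun ω => T^[i] (π ω) := fun i => (hT.iterate i).comp hπ
  have h0 : ∀ i, Integrable (fun ω => ψ (T^[i] (π ω))) (bernoulli ρ) := fun i =>
    Integrable.of_bound (hψ.comp (hTi i)).aestronglyMeasurable C (ae_of_all _ fun ω => by
      simpa using hC i ω)
  have h1 : ∀ i, Integrable ψ ((bernoulli ρ).map (fun ω => T^[i] (π ω))) := fun i =>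
    (integrable_map_measure hψ.aestronglyMeasurable (hTi i).aemeasurable).2 (h0 i)
  constructor
  · rcases Nat.eq_zero_or_pos m with rfl | hm
    · simp [tower]
    · exact (integrable_finsetSum_measure.2 fun i _ => h1 i).smul_measure (by simp [hm.ne'])
  · rw [tower, integral_smul_measure, integral_finsetSum_measure fun i _ => h1 i]
    simp only [birkhoff, ENNReal.toReal_inv, ENNReal.toReal_natCast, smul_eq_mul]
    rw [integral_finsetSum _ fun i _ => h0 i]
    congr 1
    refine Finset.sum_congr rfl fun i _ => ?_
    rw [integral_map (hTi i).aemeasurable hψ.aestronglyMeasurable]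

variable [MeasurableSingletonClass ι]

theorem setLIntegral_information_le (hρ : ∀ i, 0 < ρ.real {i}) {E : Set (ℕ → ι)}
    (hE : MeasurableSet E) (s : Finset ℕ) (hs : ∀ ω ∈ E, ∀ ω' ∈ E, ∀ j ∈ s, ω j = ω' j) :
    ∫⁻ ω in E, ENNReal.ofReal (∑ j ∈ s, -Real.log (ρ.real {ω j})) ∂(bernoulli ρ)
      ≤ ENNReal.ofReal (Real.negMulLog ((bernoulli ρ).real E)) := by
  rcases E.eq_empty_or_nonempty with rfl | ⟨ω₀, h₀⟩
  · simp
  have h1 : ∫⁻ ω in E, ENNReal.ofReal (∑ j ∈ s, -Real.log (ρ.real {ω j})) ∂(bernoulli ρ)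
      = ∫⁻ ω in E, ENNReal.ofReal (∑ j ∈ s, -Real.log (ρ.real {ω₀ j})) ∂(bernoulli ρ) := by
    refine setLIntegral_congr_fun hE fun ω hω => congrArg ENNReal.ofReal ?_
    exact Finset.sum_congr rfl fun j hj => by rw [hs ω hω ω₀ h₀ j hj]
  have h2 : (bernoulli ρ).real E ≤ ∏ j ∈ s, ρ.real {ω₀ j} := by
    have : E ⊆ Set.pi s (fun j => {ω₀ j}) := fun ω hω j hj => hs ω hω ω₀ h₀ j hj
    refine (measureReal_mono this).trans (le_of_eq ?_)
    rw [Measure.real, bernoulli, Measure.infinitePi_pi _ (by simp), ENNReal.toReal_prod]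
    rfl
  have h3 : 0 ≤ (bernoulli ρ).real E := measureReal_nonneg
  rw [h1, setLIntegral_const, ← ofReal_measureReal, ← ENNReal.ofReal_mul' h3]
  refine ENNReal.ofReal_le_ofReal ?_
  rw [Real.negMulLog]
  rcases h3.eq_or_lt with h | h
  · simp [← h]
  · have h4 := Real.log_le_log h h2
    rw [Real.log_prod (fun j _ => (hρ _).ne')] at h4
    rw [Finset.sum_neg_distrib]
    nlinarith

variable [Fintype ι]

theorem integral_eval_bernoulli (f : ι → ℝ) (j : ℕ) :
    ∫ ω, f (ω j) ∂(bernoulli ρ) = ∑ i, ρ.real {i} * f i := by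
  have := (measurePreserving_eval_infinitePi (fun _ : ℕ => ρ) j)
  have hf : Measurable f := measurable_of_finite f
  have h2 := integral_map (μ := bernoulli ρ) (f := f)
    this.measurable.aemeasurable hf.aestronglyMeasurable
  rw [show (fun ω : ℕ → ι => f (ω j)) = fun ω => f (Function.eval j ω) from rfl, ← h2, bernoulli,
    this.map_eq, integral_fintype .of_finite]
  simp

theorem lintegral_information (hρ : ∀ i, 0 < ρ.real {i}) (s : Finset ℕ) :
    ∫⁻ ω, ENNReal.ofReal (∑ j ∈ s, -Real.log (ρ.real {ω j})) ∂(bernoulli ρ)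
      = ENNReal.ofReal (s.card * ∑ i, Real.negMulLog (ρ.real {i})) := by
  have hi : ∀ j : ℕ, Integrable (fun ω : ℕ → ι => -Real.log (ρ.real {ω j})) (bernoulli ρ) :=
    fun j => by
      have := (measurePreserving_eval_infinitePi (fun _ : ℕ => ρ) j)
      exact this.integrable_comp_of_integrable
        (g := fun i => -Real.log (ρ.real {i})) (.of_finite)
  rw [← ofReal_integral_eq_lintegral_ofReal (integrable_finsetSum _ fun j _ => hi j)]
  · congr 1
    rw [integral_finsetSum _ fun j _ => hi j]
    simp_rw [integral_eval_bernoulli ρ (fun i => -Real.log (ρ.real {i}))]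
    simp [Real.negMulLog]
  · refine ae_of_all _ fun ω => Finset.sum_nonneg fun j _ => ?_
    have := Real.log_nonpos (hρ (ω j)).le measureReal_le_one
    linarith

theorem partitionEntropy_tower_ge (hT : Measurable T) (hπ : Measurable π) (hm : 0 < m)
    (hfac : ∀ ω, T^[m] (π ω) = π (fun j => ω (j + 1))) (hρ : ∀ i, 0 < ρ.real {i})
    {Q : X → ℕ} (hQ : Measurable Q) {code : ι → ℕ} (hcode : Function.Injective code)
    (hQc : ∀ ω, Q (π ω) = code (ω 0)) (n : ℕ) :
    ENNReal.ofReal (((n / m - 1 : ℕ) : ℝ) * ∑ i, Real.negMulLog (ρ.real {i})) ≤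
      partitionEntropy (tower T m π ρ) (fun x => fun i : Fin n => Q (T^[i] x)) := by
  set g : X → Fin n → ℕ := fun x => fun i : Fin n => Q (T^[i] x) with hg
  have hgm : Measurable g := measurable_pi_lambda _ fun i => hQ.comp (hT.iterate i)
  have hTi : ∀ i, Measurable fun ω => T^[i] (π ω) := fun i => (hT.iterate i).comp hπ
  set E : ℕ → (Fin n → ℕ) → Set (ℕ → ι) := fun i a => (fun ω => g (T^[i] (π ω))) ⁻¹' {a} with hE
  have hEm : ∀ i a, MeasurableSet (E i a) := fun i a =>
    (hgm.comp (hTi i)) (measurableSet_singleton a)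
  have htow : ∀ a, (tower T m π ρ (g ⁻¹' {a})).toReal
      = ∑ i ∈ Finset.range m, (m : ℝ)⁻¹ • (bernoulli ρ).real (E i a) := fun a => by
    rw [tower, Measure.smul_apply, Measure.finsetSum_apply, smul_eq_mul, ENNReal.toReal_mul,
      ENNReal.toReal_sum (fun i _ => ?_), Finset.mul_sum]
    · refine Finset.sum_congr rfl fun i _ => ?_
      rw [Measure.map_apply (hTi i) (hgm (measurableSet_singleton a))]
      simp [Measure.real, hE, Set.preimage]
    · rw [Measure.map_apply (hTi i) (hgm (measurableSet_singleton a))]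
      exact measure_ne_top _ _
  have hmr : (0 : ℝ) < m := by exact_mod_cast hm
  have hjen : ∀ a, ∑ i ∈ Finset.range m, (m : ℝ)⁻¹ * Real.negMulLog ((bernoulli ρ).real (E i a))
      ≤ Real.negMulLog ((tower T m π ρ (g ⁻¹' {a})).toReal) := fun a => by
    rw [htow]
    exact Real.concaveOn_negMulLog.le_map_sum (fun _ _ => by positivity)
      (by simp [hmr.ne']) (fun _ _ => measureReal_nonneg)
  have hnn : ∀ i a, 0 ≤ Real.negMulLog ((bernoulli ρ).real (E i a)) := fun i a =>
    Real.negMulLog_nonneg measureReal_nonneg measureReal_le_one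
  set s := Finset.Ico 1 (n / m) with hs
  have hagree : ∀ i < m, ∀ a, ∀ ω ∈ E i a, ∀ ω' ∈ E i a, ∀ j ∈ s, ω j = ω' j := by
    intro i hi a ω hω ω' hω' j hj
    obtain ⟨hj1, hj2⟩ := Finset.mem_Ico.1 hj
    have h1 : m ≤ m * j := Nat.le_mul_of_pos_right _ hj1
    have h2 : m * j < n :=
      calc m * j < m * (n / m) := Nat.mul_lt_mul_of_pos_left hj2 hm
        _ ≤ n := Nat.mul_div_le n m
    have key : ∀ ω'' ∈ E i a, code (ω'' j) = a ⟨m * j - i, by omega⟩ := by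
      intro ω'' hω''
      have h3 : g (T^[i] (π ω'')) = a := hω''
      have h4 := congrFun h3 ⟨m * j - i, by omega⟩
      simp only [hg] at h4
      rw [← h4, ← Function.iterate_add_apply, show m * j - i + i = m * j by omega,
        iterate_mul_of_factor hfac, hQc]
      simp
    exact hcode ((key ω hω).trans (key ω' hω').symm)
  have hsum : ∀ i < m, ENNReal.ofReal (((n / m - 1 : ℕ) : ℝ) * ∑ i, Real.negMulLog (ρ.real {i}))
      ≤ ∑' a, ENNReal.ofReal (Real.negMulLog ((bernoulli ρ).real (E i a))) := by
    intro i hi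
    have h1 := lintegral_information ρ hρ s
    rw [show (s.card : ℝ) = ((n / m - 1 : ℕ) : ℝ) by simp [hs]] at h1
    rw [← h1, ← setLIntegral_univ, ← show (⋃ a, E i a) = univ by
      ext ω; simp [hE], lintegral_iUnion (hEm i)]
    · exact ENNReal.tsum_le_tsum fun a => setLIntegral_information_le ρ hρ (hEm i a) s (hagree i hi a)
    · intro a b hab
      exact Disjoint.preimage _ (by simpa using hab)
  rw [partitionEntropy]
  calc _ = ∑ i ∈ Finset.range m, ENNReal.ofReal ((m : ℝ)⁻¹) *
        ENNReal.ofReal (((n / m - 1 : ℕ) : ℝ) * ∑ i, Real.negMulLog (ρ.real {i})) := by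
        rw [Finset.sum_const, Finset.card_range, nsmul_eq_mul, ← mul_assoc,
          ENNReal.ofReal_inv_of_pos hmr, ENNReal.ofReal_natCast,
          ENNReal.mul_inv_cancel (by exact_mod_cast hm.ne') (by simp), one_mul]
    _ ≤ ∑ i ∈ Finset.range m, ENNReal.ofReal ((m : ℝ)⁻¹) *
        ∑' a, ENNReal.ofReal (Real.negMulLog ((bernoulli ρ).real (E i a))) := by
        gcongr with i hi
        exact hsum i (Finset.mem_range.1 hi)
    _ = ∑' a, ∑ i ∈ Finset.range m, ENNReal.ofReal ((m : ℝ)⁻¹) *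
        ENNReal.ofReal (Real.negMulLog ((bernoulli ρ).real (E i a))) := by
        rw [Summable.tsum_finsetSum (fun _ _ => ENNReal.summable)]
        simp_rw [ENNReal.tsum_mul_left]
    _ ≤ _ := by
        refine ENNReal.tsum_le_tsum fun a => ?_
        have := hjen a
        rw [Real.negMulLog, neg_mul] at this
        refine le_trans (le_of_eq ?_) (ENNReal.ofReal_le_ofReal this)
        rw [ENNReal.ofReal_sum_of_nonneg fun i _ => mul_nonneg (by positivity) (hnn i a)]
        exact Finset.sum_congr rfl fun i _ => (ENNReal.ofReal_mul (by positivity)).symm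

theorem entropy_tower_ge (hT : Measurable T) (hπ : Measurable π) (hm : 0 < m)
    (hfac : ∀ ω, T^[m] (π ω) = π (fun j => ω (j + 1))) (hρ : ∀ i, 0 < ρ.real {i})
    {Q : X → ℕ} (hQ : Measurable Q) (hQfin : (range Q).Finite) {code : ι → ℕ}
    (hcode : Function.Injective code) (hQc : ∀ ω, Q (π ω) = code (ω 0)) :
    ENNReal.ofReal ((m : ℝ)⁻¹ * ∑ i, Real.negMulLog (ρ.real {i})) ≤
      entropy T (tower T m π ρ) := by
  set H := ∑ i, Real.negMulLog (ρ.real {i}) with hH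
  have hH0 : 0 ≤ H := Finset.sum_nonneg fun i _ =>
    Real.negMulLog_nonneg measureReal_nonneg measureReal_le_one
  have hmr : (0 : ℝ) < m := by exact_mod_cast hm
  refine le_trans ?_ (le_iSup₂_of_le Q ⟨hQ, hQfin⟩ le_rfl)
  have hlim : Tendsto (fun n : ℕ => ((m : ℝ)⁻¹ - 2 * (n : ℝ)⁻¹) * H) atTop
      (𝓝 (((m : ℝ)⁻¹ - 2 * 0) * H)) :=
    ((tendsto_inv_atTop_nhds_zero_nat (𝕜 := ℝ)).const_mul 2).const_sub _ |>.mul_const H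
  rw [mul_zero, sub_zero] at hlim
  rw [← (ENNReal.tendsto_ofReal hlim).liminf_eq]
  refine liminf_le_liminf ?_
  filter_upwards [eventually_gt_atTop 0] with n hn
  have hnr : (0 : ℝ) < n := by exact_mod_cast hn
  refine le_trans ?_ (mul_le_mul_right (partitionEntropy_tower_ge ρ hT hπ hm hfac hρ hQ hcode hQc n) _)
  rw [← ENNReal.ofReal_mul (by positivity), ← mul_assoc]
  refine ENNReal.ofReal_le_ofReal (mul_le_mul_of_nonneg_right ?_ hH0)
  have h1 : (n : ℝ) / m - 2 ≤ ((n / m - 1 : ℕ) : ℝ) := by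
    have h2 : (n : ℝ) / m < ((n / m : ℕ) : ℝ) + 1 := by
      rw [div_lt_iff₀ hmr]
      exact_mod_cast Nat.lt_mul_of_div_lt (Nat.lt_succ_self _) hm
    have h3 : ((n / m : ℕ) : ℝ) ≤ ((n / m - 1 : ℕ) : ℝ) + 1 := by
      exact_mod_cast (by omega : n / m ≤ n / m - 1 + 1)
    linarith
  calc (m : ℝ)⁻¹ - 2 * (n : ℝ)⁻¹ = (n : ℝ)⁻¹ * ((n : ℝ) / m - 2) := by field_simp
    _ ≤ _ := by gcongr

end Tower

/-! ### Paths and concatenations -/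

section Paths

variable {S : Type*} {A : S → S → Prop}

theorem shift_iterate_apply (x : Space A) (i k : ℕ) : ((shift A)^[i] x).1 k = x.1 (k + i) := by
  induction i generalizing x with
  | zero => rfl
  | succ i ih =>
    rw [Function.iterate_succ_apply, ih]
    simp [shift, add_assoc]

variable (A) in
/-- `b 0, …, b m` is an admissible path from `a` to `e`. -/
def IsPath (a e : S) (m : ℕ) (b : ℕ → S) : Prop :=
  b 0 = a ∧ b m = e ∧ ∀ i < m, A (b i) (b (i + 1))

/-- The point obtained by following successively the loops `b (ω 0), b (ω 1), …`. -/
def concat {ι : Type*} {a : S} {m : ℕ} (hm : 0 < m) {b : ι → ℕ → S}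
    (hb : ∀ d, IsPath A a a m (b d)) (ω : ℕ → ι) : Space A :=
  ⟨fun k => b (ω (k / m)) (k % m), fun k => by
    show A (b (ω (k / m)) (k % m)) (b (ω ((k + 1) / m)) ((k + 1) % m))
    have hlt := Nat.mod_lt k hm
    have hdm := Nat.div_add_mod k m
    have hA := (hb (ω (k / m))).2.2 _ hlt
    rcases (Nat.succ_le_of_lt hlt).lt_or_eq with h | h
    · have h1 : (k + 1) / m = k / m := by
        have hk : k + 1 = m * (k / m) + (k % m + 1) := by omega
        rw [hk, Nat.mul_add_div hm, Nat.div_eq_of_lt h, add_zero]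
      have h2 : (k + 1) % m = k % m + 1 := by
        have := Nat.div_add_mod (k + 1) m
        rw [h1] at this
        omega
      rw [h1, h2]
      exact hA
    · have hk : k + 1 = m * (k / m + 1) := by rw [Nat.mul_add, mul_one]; omega
      have h1 : (k + 1) / m = k / m + 1 := by rw [hk, Nat.mul_div_cancel_left _ hm]
      have h2 : (k + 1) % m = 0 := by rw [hk, Nat.mul_mod_right]
      rw [h1, h2, (hb _).1]
      rw [← Nat.succ_eq_add_one, h, (hb _).2.1] at hA
      exact hA⟩

theorem shift_iterate_concat {ι : Type*} {a : S} {m : ℕ} (hm : 0 < m) {b : ι → ℕ → S}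
    (hb : ∀ d, IsPath A a a m (b d)) (ω : ℕ → ι) :
    (shift A)^[m] (concat hm hb ω) = concat hm hb (fun j => ω (j + 1)) := by
  refine Subtype.ext (funext fun k => ?_)
  rw [shift_iterate_apply]
  simp [concat, Nat.add_div_right _ hm]

theorem concat_apply_of_lt {ι : Type*} {a : S} {m : ℕ} (hm : 0 < m) {b : ι → ℕ → S}
    (hb : ∀ d, IsPath A a a m (b d)) (ω : ℕ → ι) {i : ℕ} (hi : i < m) :
    (concat hm hb ω).1 i = b (ω 0) i := by
  simp [concat, Nat.div_eq_of_lt hi, Nat.mod_eq_of_lt hi]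

/-- The point obtained by following the path `b` and then `z`. -/
def prepend {a : S} {m : ℕ} {b : ℕ → S} {z : Space A} (hb : IsPath A a (z.1 0) m b) : Space A :=
  ⟨fun k => if k < m then b k else z.1 (k - m), fun k => by
    rcases lt_trichotomy (k + 1) m with h | h | h
    · simp only [h, show k < m by omega, if_true]
      exact hb.2.2 k (by omega)
    · subst h
      simp only [lt_irrefl, show k < k + 1 by omega, if_true, if_false, Nat.sub_self]
      rw [← hb.2.1]
      exact hb.2.2 k (by omega)
    · simp only [show ¬ k < m by omega, show ¬ k + 1 < m by omega, if_false]
      rw [show k + 1 - m = k - m + 1 by omega]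
      exact z.2 _⟩

theorem shift_iterate_prepend {a : S} {m : ℕ} {b : ℕ → S} {z : Space A}
    (hb : IsPath A a (z.1 0) m b) : (shift A)^[m] (prepend hb) = z := by
  refine Subtype.ext (funext fun k => ?_)
  rw [shift_iterate_apply]
  simp [prepend]

theorem admissible_word (x : Space A) {n : ℕ} (hn : 0 < n) : Admissible A (word x n) := by
  refine ⟨by simp [word, hn.ne'], ?_⟩
  show List.IsChain A _
  rw [List.isChain_iff_getElem]
  intro i hi
  simpa [word] using x.2 i

theorem exists_path_through {Λ : Finset (List S)}
    (hΛ : ∀ v w : List S, Admissible A v → Admissible A w → ∃ l ∈ Λ, Admissible A (v ++ l ++ w))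
    (a e : S) (x : Space A) {n : ℕ} (hn : 0 < n) :
    ∃ l ∈ Λ, ∃ r ∈ Λ, ∃ b : ℕ → S, IsPath A a e (1 + l.length + n + r.length) b ∧
      (∀ i < n, b (1 + l.length + i) = x.1 i) ∧
      (∀ i < 1 + l.length, b i = a ∨ ∃ s ∈ Λ, b i ∈ s) ∧
      (∀ i < r.length, b (1 + l.length + n + i) = a ∨ ∃ s ∈ Λ, b (1 + l.length + n + i) ∈ s) := by
  have hsing : ∀ c : S, Admissible A [c] := fun c => ⟨by simp, List.isChain_singleton c⟩
  obtain ⟨l, hl, h1⟩ := hΛ [a] (word x n) (hsing a) (admissible_word x hn)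
  obtain ⟨r, hr, h2⟩ := hΛ (word x n) [e] (admissible_word x hn) (hsing e)
  have hwl : (word x n).length = n := by simp [word]
  have hch : List.IsChain A (([a] ++ l) ++ word x n ++ (r ++ [e])) :=
    List.IsChain.append_overlap h1.2 (by rw [← List.append_assoc]; exact h2.2)
      (admissible_word x hn).1
  set L := ([a] ++ l) ++ word x n ++ (r ++ [e]) with hL
  have hLl : L.length = 1 + l.length + n + r.length + 1 := by
    simp [hL, hwl]; omega
  rw [List.isChain_iff_getElem] at hch
  refine ⟨l, hl, r, hr, fun i => L.getD i a, ⟨?_, ?_, ?_⟩, ?_, ?_, ?_⟩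
  · simp [hL]
  · have : L = (([a] ++ l) ++ word x n ++ r) ++ [e] := by simp [hL]
    simp only [this]
    rw [List.getD_append_right _ _ _ _ (by simp [hwl]; omega)]
    simp [hwl, show 1 + l.length + n + r.length - (l.length + (n + r.length) + 1) = 0 by omega]
  · intro i hi
    simp only
    rw [List.getD_eq_getElem _ _ (by omega), List.getD_eq_getElem _ _ (by omega)]
    exact hch i (by omega)
  · intro i hi
    simp only [hL]
    rw [List.getD_append _ _ _ _ (by simp [hwl]; omega),
      List.getD_append_right _ _ _ _ (by simp; omega)]
    rw [List.getD_eq_getElem _ _ (by simp [hwl]; omega)]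
    simp [word, show 1 + l.length + i - (l.length + 1) = i by omega]
  · intro i hi
    simp only [hL]
    rw [List.getD_append _ _ _ _ (by simp [hwl]; omega),
      List.getD_append _ _ _ _ (by simp; omega), List.getD_eq_getElem _ _ (by simp; omega)]
    have : ([a] ++ l)[i]'(by simp; omega) ∈ [a] ++ l := List.getElem_mem _
    rcases List.mem_append.1 this with h | h
    · left; simpa using h
    · exact Or.inr ⟨l, hl, h⟩
  · intro i hi
    right
    refine ⟨r, hr, ?_⟩
    have h3 : L.getD (1 + l.length + n + i) a = r[i] := by
      simp only [hL]
      rw [List.getD_append_right _ _ _ _ (by simp [hwl]; omega),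
        List.getD_append _ _ _ _ (by simp [hwl]; omega), List.getD_eq_getElem _ _ (by simp [hwl]; omega)]
      congr 1
      simp [hwl]; omega
    simp only [h3]
    exact List.getElem_mem _

end Paths

/-! ### Birkhoff sums -/

section Birkhoff

theorem birkhoff_add {X : Type*} (T : X → X) (ψ : X → ℝ) (p q : ℕ) (x : X) :
    birkhoff T ψ (p + q) x = birkhoff T ψ p x + birkhoff T ψ q (T^[p] x) := by
  rw [birkhoff, Finset.sum_range_add]
  simp only [birkhoff, add_comm p, Function.iterate_add_apply]

theorem neg_mul_le_birkhoff {X : Type*} (T : X → X) (ψ : X → ℝ) {q : ℕ} {x : X} {M : ℝ}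
    (h : ∀ i < q, -M ≤ ψ (T^[i] x)) : -(q * M) ≤ birkhoff T ψ q x := by
  have := Finset.card_nsmul_le_sum (Finset.range q) (fun i => ψ (T^[i] x)) (-M)
    (fun i hi => h i (Finset.mem_range.1 hi))
  simpa [birkhoff] using this

variable {S : Type*} {A : S → S → Prop}

theorem birkhoff_ge_of_block {ψ : Space A → ℝ} {k n r : ℕ} {x y : Space A} {M K : ℝ}
    (hx : ∀ i < n, y.1 (k + i) = x.1 i)
    (hψ : ∀ z : Space A, (∀ i < n, z.1 i = x.1 i) →
      birkhoff (shift A) ψ n x - K ≤ birkhoff (shift A) ψ n z)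
    (h1 : ∀ i < k, -M ≤ ψ ((shift A)^[i] y)) (h2 : ∀ i < r, -M ≤ ψ ((shift A)^[k + n + i] y)) :
    birkhoff (shift A) ψ n x - K - (k + r) * M ≤ birkhoff (shift A) ψ (k + n + r) y := by
  rw [birkhoff_add, birkhoff_add]
  have e1 := neg_mul_le_birkhoff (shift A) ψ h1
  have e2 : -(r * M) ≤ birkhoff (shift A) ψ r ((shift A)^[k + n] y) :=
    neg_mul_le_birkhoff (shift A) ψ fun i hi => by
      rw [← Function.iterate_add_apply, add_comm i]
      exact h2 i hi
  have e3 := hψ ((shift A)^[k] y) fun i hi => by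
    rw [shift_iterate_apply, add_comm]; exact hx i hi
  linarith

theorem UnifCont.abs_birkhoff_sub_le {ψ : Space A → ℝ} (hu : UnifCont A ψ) (hb : Bdd A ψ)
    {δ : ℝ} (hδ : 0 < δ) : ∃ K : ℝ, 0 ≤ K ∧ ∀ (n : ℕ) (x y : Space A),
      (∀ i < n, x.1 i = y.1 i) →
        |birkhoff (shift A) ψ n x - birkhoff (shift A) ψ n y| ≤ n * δ + K := by
  obtain ⟨N, hN⟩ := hu δ hδ
  obtain ⟨C, hC⟩ := hb
  by_cases hne : IsEmpty (Space A)
  · exact ⟨0, le_rfl, fun n x => hne.elim x⟩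
  obtain ⟨x₀⟩ := not_isEmpty_iff.1 hne
  have hC0 : 0 ≤ C := (abs_nonneg _).trans (hC x₀)
  refine ⟨N * (2 * C), by positivity, fun n x y hxy => ?_⟩
  rw [birkhoff, birkhoff, ← Finset.sum_sub_distrib]
  refine (Finset.abs_sum_le_sum_abs _ _).trans ?_
  have hterm : ∀ i ∈ Finset.range n, |ψ ((shift A)^[i] x) - ψ ((shift A)^[i] y)|
      ≤ δ + if n < i + N then 2 * C else 0 := by
    intro i _
    split_ifs with h
    · have := abs_sub (ψ ((shift A)^[i] x)) (ψ ((shift A)^[i] y))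
      linarith [hC ((shift A)^[i] x), hC ((shift A)^[i] y)]
    · rw [add_zero]
      refine hN _ _ fun j hj => ?_
      rw [shift_iterate_apply, shift_iterate_apply]
      exact hxy _ (by omega)
  refine (Finset.sum_le_sum hterm).trans ?_
  rw [Finset.sum_add_distrib, Finset.sum_const, Finset.card_range, nsmul_eq_mul,
    ← Finset.sum_filter, Finset.sum_const, nsmul_eq_mul]
  have hcard : ((Finset.range n).filter fun i => n < i + N).card ≤ N := by
    refine (Finset.card_le_card (t := Finset.Ico (n - N) n) fun i hi => ?_).trans (by simp; omega)
    simp only [Finset.mem_filter, Finset.mem_range, Finset.mem_Ico] at hi ⊢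
    omega
  gcongr

variable [TopologicalSpace S]

theorem IsGibbsWith.birkhoff_sub_le {φ : Space A → ℝ} {μ : Measure (Space A)} {c₀ P : ℝ}
    (hG : IsGibbsWith A φ μ c₀ P) (hc₀ : 1 ≤ c₀) {n : ℕ} (hn : 1 ≤ n) {x y : Space A}
    (hxy : ∀ i < n, x.1 i = y.1 i) :
    birkhoff (shift A) φ n x - 2 * Real.log c₀ ≤ birkhoff (shift A) φ n y := by
  have hw : word x n = word y n := by
    simp only [word]
    congr 1
    funext i
    exact hxy i i.2
  have h1 := (hG n hn x).1.trans (hw ▸ (hG n hn y).2)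
  have hpos : 0 < c₀ := by linarith
  have h2 := Real.log_le_log (by positivity) h1
  rw [Real.log_mul (by positivity) (by positivity), Real.log_mul (by positivity) (by positivity),
    Real.log_inv, Real.log_exp, Real.log_exp] at h2
  linarith

theorem IsGibbsWith.exists_abs_le {φ : Space A → ℝ} {μ : Measure (Space A)} {c₀ P : ℝ}
    (hG : IsGibbsWith A φ μ c₀ P) (hc₀ : 1 ≤ c₀) {F : Set S} (hF : F.Finite) :
    ∃ M : ℝ, 0 ≤ M ∧ ∀ z : Space A, z.1 0 ∈ F → |φ z| ≤ M := by
  have h1 : ∀ x y : Space A, x.1 0 = y.1 0 → φ x - 2 * Real.log c₀ ≤ φ y := fun x y h => by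
    simpa [birkhoff] using hG.birkhoff_sub_le hc₀ le_rfl (x := x) (y := y)
      (fun i hi => by rwa [Nat.lt_one_iff.1 hi])
  have h2 : ∀ s : S, ∃ M : ℝ, ∀ z : Space A, z.1 0 = s → |φ z| ≤ M := fun s => by
    by_cases h : ∃ x : Space A, x.1 0 = s
    · obtain ⟨x, hx⟩ := h
      refine ⟨|φ x| + 2 * Real.log c₀, fun z hz => ?_⟩
      have e1 := h1 x z (hx.trans hz.symm)
      have e2 := h1 z x (hz.trans hx.symm)
      rw [abs_le]
      constructor <;> linarith [le_abs_self (φ x), neg_abs_le (φ x)]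
    · exact ⟨0, fun z hz => (h ⟨z, hz⟩).elim⟩
  choose M hM using h2
  obtain ⟨B, hB⟩ := (hF.image M).bddAbove
  refine ⟨max B 0, le_max_right _ _, fun z hz => (hM _ z rfl).trans ?_⟩
  exact (hB (mem_image_of_mem M hz)).trans (le_max_left _ _)

end Birkhoff

/-! ### Invariant measures carried by families of loops -/

section Loops

variable {S : Type*} [TopologicalSpace S] {A : S → S → Prop}

theorem continuous_shift : Continuous (shift A) := by
  refine Continuous.subtype_mk (continuous_pi fun i => ?_) _
  exact (continuous_apply (i + 1)).comp continuous_subtype_val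

theorem continuous_eval (i : ℕ) : Continuous fun x : Space A => x.1 i :=
  (continuous_apply i).comp continuous_subtype_val

theorem continuous_concat {ι : Type*} [TopologicalSpace ι] [DiscreteTopology ι] {a : S} {m : ℕ}
    (hm : 0 < m) {b : ι → ℕ → S} (hb : ∀ d, IsPath A a a m (b d)) :
    Continuous (concat hm hb) := by
  refine Continuous.subtype_mk (continuous_pi fun k => ?_) _
  exact (continuous_of_discreteTopology (f := fun d => b d (k % m))).comp (continuous_apply (k / m))

theorem le_freeEnergy {φ : Space A → ℝ} {P h c : ℝ} {ν : ProbabilityMeasure (Space A)}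
    (hinv : Invariant (shift A) (ν : Measure (Space A)))
    (hent : ENNReal.ofReal h ≤ entropy (shift A) (ν : Measure (Space A)))
    (hint : Integrable φ (ν : Measure (Space A))) (hc : c ≤ ∫ x, φ x ∂(ν : Measure (Space A))) :
    ((h + c - P : ℝ) : EReal) ≤ freeEnergy (shift A) φ P ν := by
  have hneg : (∫⁻ x, ENNReal.ofReal (-φ x) ∂(ν : Measure (Space A))) ≠ ⊤ :=
    hint.neg.lintegral_lt_top.ne
  have hpos : (∫⁻ x, ENNReal.ofReal (φ x) ∂(ν : Measure (Space A))) ≠ ⊤ :=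
    hint.lintegral_lt_top.ne
  rw [freeEnergy, if_pos ⟨hinv, hneg⟩]
  have h1 : eintegral φ (ν : Measure (Space A)) = ((∫ x, φ x ∂(ν : Measure (Space A)) : ℝ) : EReal) := by
    rw [eintegral, integral_eq_lintegral_pos_part_sub_lintegral_neg_part hint, EReal.coe_sub,
      EReal.coe_ennreal_toReal, EReal.coe_ennreal_toReal] <;> assumption
  have h2 : (h : EReal) ≤ (entropy (shift A) (ν : Measure (Space A)) : EReal) := by
    refine le_trans ?_ (EReal.coe_ennreal_le_coe_ennreal_iff.2 hent)
    rw [EReal.coe_ennreal_ofReal]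
    exact_mod_cast le_max_left _ _
  rw [h1, EReal.coe_sub, EReal.coe_add]
  exact EReal.sub_le_sub (add_le_add h2 (by exact_mod_cast hc)) le_rfl

variable [DiscreteTopology S]

theorem exists_code {ι : Type*} [Fintype ι] {m : ℕ} {b : ι → ℕ → S}
    (hinj : ∀ d d', (∀ i < m, b d i = b d' i) → d = d') :
    ∃ Q : Space A → ℕ, Measurable Q ∧ (range Q).Finite ∧ ∃ code : ι → ℕ,
      Function.Injective code ∧ ∀ d (y : Space A), (∀ i < m, y.1 i = b d i) → Q y = code d := by
  classical
  let code : ι → ℕ := fun d => (Fintype.equivFin ι d : ℕ)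
  let w : ι → Fin m → S := fun d i => b d i
  have hw : Function.Injective w := fun d d' h => hinj d d' fun i hi => congrFun h ⟨i, hi⟩
  let q : (Fin m → S) → ℕ := Function.extend w code 0
  let res : Space A → Fin m → S := fun y i => y.1 i
  have hres : Continuous res := continuous_pi fun i => continuous_eval _
  refine ⟨q ∘ res, (continuous_of_discreteTopology.comp hres).measurable, ?_, code, ?_, ?_⟩
  · refine Set.Finite.subset ?_ ((range_comp_subset_range res q).trans
      (range_extend_subset w code 0))
    refine (finite_range code).union (Set.Finite.subset (finite_singleton 0) ?_)
    rintro _ ⟨_, _, rfl⟩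
    rfl
  · exact Fin.val_injective.comp (Fintype.equivFin ι).injective
  · intro d y hy
    have : res y = w d := funext fun i => hy i i.2
    simp only [Function.comp_apply, this, q]
    exact hw.extend_apply _ _ _

theorem exists_invariant_measure {ι : Type*} [Fintype ι] {p : ι → ℝ} (hp : ∀ d, 0 < p d)
    (hp1 : ∑ d, p d = 1) {a : S} {m : ℕ} (hm : 0 < m) {b : ι → ℕ → S}
    (hb : ∀ d, IsPath A a a m (b d)) (hinj : ∀ d d', (∀ i < m, b d i = b d' i) → d = d') :
    ∃ ν : ProbabilityMeasure (Space A), Invariant (shift A) (ν : Measure (Space A)) ∧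
      ENNReal.ofReal ((m : ℝ)⁻¹ * ∑ d, Real.negMulLog (p d))
        ≤ entropy (shift A) (ν : Measure (Space A)) ∧
      ∀ (ψ : Space A → ℝ) (C : ℝ) (f : ι → ℝ), Measurable ψ →
        (∀ y : Space A, (∃ d, ∃ i < m, y.1 0 = b d i) → |ψ y| ≤ C) →
        (∀ d (y : Space A), (∀ i < m, y.1 i = b d i) → f d ≤ birkhoff (shift A) ψ m y) →
        Integrable ψ (ν : Measure (Space A)) ∧
          (m : ℝ)⁻¹ * ∑ d, p d * f d ≤ ∫ x, ψ x ∂(ν : Measure (Space A)) := by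
  classical
  let : TopologicalSpace ι := ⊥
  have : DiscreteTopology ι := ⟨rfl⟩
  let : MeasurableSpace ι := ⊤
  have : BorelSpace ι := ⟨borel_eq_top_of_discrete.symm⟩
  let ρ : Measure ι := ∑ d, ENNReal.ofReal (p d) • Measure.dirac d
  have hρ1 : ∀ d, ρ {d} = ENNReal.ofReal (p d) := fun d => by
    simp [ρ, Measure.finsetSum_apply, Set.indicator_apply, Finset.sum_ite_eq']
  have hρ : ∀ d, ρ.real {d} = p d := fun d => by
    rw [Measure.real, hρ1, ENNReal.toReal_ofReal (hp d).le]
  have : IsProbabilityMeasure ρ := ⟨by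
    simp [ρ, Measure.finsetSum_apply, ← ENNReal.ofReal_sum_of_nonneg fun d _ => (hp d).le, hp1]⟩
  have hT : Measurable (shift A) := continuous_shift.measurable
  have hπ : Measurable (concat hm hb) := (continuous_concat hm hb).measurable
  have hfac := shift_iterate_concat hm hb
  have := isProbabilityMeasure_tower ρ hT hπ hm
  refine ⟨⟨tower (shift A) m (concat hm hb) ρ, this⟩, invariant_tower ρ hT hπ hfac, ?_, ?_⟩
  · obtain ⟨Q, hQ, hQf, code, hcode, hQc⟩ := exists_code (A := A) hinj
    have := entropy_tower_ge ρ hT hπ hm hfac (fun d => by rw [hρ]; exact hp d) hQ hQf hcode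
      (fun ω => hQc (ω 0) _ fun i hi => concat_apply_of_lt hm hb ω hi)
    simp only [hρ] at this
    exact this
  · intro ψ C f hψ hC hf
    have hbd : ∀ i ω, |ψ ((shift A)^[i] (concat hm hb ω))| ≤ C := fun i ω =>
      hC _ ⟨ω (i / m), i % m, Nat.mod_lt _ hm, by rw [shift_iterate_apply, zero_add]; rfl⟩
    obtain ⟨h1, h2⟩ := integral_tower (m := m) ρ hT hπ hψ hbd
    refine ⟨h1, ?_⟩
    simp only [ProbabilityMeasure.coe_mk]
    rw [h2]
    refine mul_le_mul_of_nonneg_left ?_ (by positivity)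
    simp_rw [← hρ]
    rw [← integral_eval_bernoulli ρ f 0]
    refine integral_mono ?_ ?_ fun ω => hf _ _ fun i hi => concat_apply_of_lt hm hb ω hi
    · exact (measurePreserving_eval_infinitePi (fun _ : ℕ => ρ) 0).integrable_comp_of_integrable
        (g := f) .of_finite
    · refine integrable_finsetSum _ fun i _ => Integrable.of_bound
        (hψ.comp ((hT.iterate i).comp hπ)).aestronglyMeasurable C (ae_of_all _ fun ω => by
          simpa using hbd i ω)

end Loops

/-! ### The main construction -/

theorem mem_cylinder_word {S : Type*} {A : S → S → Prop} {x y : Space A} {n : ℕ} :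
    y ∈ cylinder A (word x n) ↔ ∀ i < n, y.1 i = x.1 i := by
  simp only [cylinder, mem_ofPred_eq, List.get_eq_getElem, word, List.getElem_ofFn]
  exact ⟨fun h i hi => h ⟨i, by simpa using hi⟩, fun h i => h i (by simpa using i.2)⟩

theorem finite_eq_or_mem {S : Type*} (Λ : Finset (List S)) (a : S) :
    {s | s = a ∨ ∃ t ∈ Λ, s ∈ t}.Finite := by
  have : {s | s = a ∨ ∃ t ∈ Λ, s ∈ t} = insert a (⋃ t ∈ (Λ : Set (List S)), {s | s ∈ t}) := by
    ext s; simp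
  rw [this]
  exact (Λ.finite_toSet.biUnion fun t _ => List.finite_toSet t).insert a

section Construction

variable {S : Type*} [TopologicalSpace S] [DiscreteTopology S] {A : S → S → Prop}

theorem UnifCont.continuous {ψ : Space A → ℝ} (hu : UnifCont A ψ) : Continuous ψ := by
  rw [continuous_iff_continuousAt]
  intro x
  rw [ContinuousAt, Metric.tendsto_nhds]
  intro δ hδ
  obtain ⟨N, hN⟩ := hu (δ / 2) (by linarith)
  have : ∀ i ∈ Finset.range N, ∀ᶠ y : Space A in 𝓝 x, y.1 i = x.1 i := fun i _ =>
    ((isOpen_discrete {x.1 i}).preimage (continuous_eval (A := A) i)).mem_nhds rfl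
  filter_upwards [(Filter.eventually_all_finset _).2 this] with y hy
  have := hN y x fun i hi => hy i (Finset.mem_range.2 hi)
  rw [Real.dist_eq]
  linarith

theorem measurableSet_cylinder (w : List S) : MeasurableSet (cylinder A w) := by
  have : cylinder A w = ⋂ i : Fin w.length, (fun x : Space A => x.1 i) ⁻¹' {w.get i} := by
    ext; simp [cylinder]
  rw [this]
  exact MeasurableSet.iInter fun i =>
    ((isOpen_discrete _).preimage (continuous_eval (A := A) i)).measurableSet

theorem sum_exp_birkhoff_le [Countable S] {φ : Space A → ℝ} {μ : Measure (Space A)} [IsProbabilityMeasure μ]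
    {c₀ P : ℝ} (hc₀ : 1 ≤ c₀) (hG : IsGibbsWith A φ μ c₀ P) {n : ℕ} (hn : 1 ≤ n)
    (D : Finset (Space A)) (hD : ∀ x ∈ D, ∀ y ∈ D, (∀ i < n, x.1 i = y.1 i) → x = y) :
    ∑ x ∈ D, Real.exp (birkhoff (shift A) φ n x - P * n) ≤ c₀ := by
  have hpos : 0 < c₀ := by linarith
  have h1 : ∑ x ∈ D, μ (cylinder A (word x n)) ≤ 1 := by
    rw [← measure_univ (μ := μ)]
    refine sum_measure_le_measure_univ (fun x _ => (measurableSet_cylinder _).nullMeasurableSet) ?_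
    intro x hx y hy hxy
    refine Disjoint.aedisjoint (Set.disjoint_left.2 fun z hz hz' => hxy ?_)
    exact hD x hx y hy fun i hi => (mem_cylinder_word.1 hz i hi).symm.trans (mem_cylinder_word.1 hz' i hi)
  have h2 : ∑ x ∈ D, μ.real (cylinder A (word x n)) ≤ 1 := by
    have := ENNReal.toReal_mono (by simp) h1
    rwa [ENNReal.toReal_sum fun _ _ => measure_ne_top _ _, ENNReal.toReal_one] at this
  calc ∑ x ∈ D, Real.exp (birkhoff (shift A) φ n x - P * n)
      ≤ ∑ x ∈ D, c₀ * μ.real (cylinder A (word x n)) := by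
        refine Finset.sum_le_sum fun x _ => ?_
        have := (hG n hn x).1
        rw [inv_mul_le_iff₀ hpos] at this
        rwa [sub_eq_neg_add]
    _ ≤ c₀ := by
        rw [← Finset.mul_sum]
        nlinarith

theorem exists_freeEnergy_ge [Countable S] (hirr : FinitelyIrreducible A) {φ : Space A → ℝ}
    (hφ : Measurable φ) {μ : Measure (Space A)} [IsProbabilityMeasure μ] {c₀ P : ℝ} (hc₀ : 1 ≤ c₀)
    (hG : IsGibbsWith A φ μ c₀ P) {l : ℕ} {φs : Fin l → Space A → ℝ}
    (hφs : ∀ j, UnifCont A (φs j) ∧ Bdd A (φs j)) (αs : Fin l → ℝ) {ε : ℝ} (hε : 0 < ε) (a : S) :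
    ∃ (K : ℝ) (N₀ : ℕ), 1 ≤ N₀ ∧ ∀ n ≥ N₀, ∀ D : Finset (Space A), D.Nonempty →
      (∀ x ∈ D, ∀ y ∈ D, (∀ i < n, x.1 i = y.1 i) → x = y) →
      (∀ x ∈ D, ∀ j, n * αs j ≤ birkhoff (shift A) (φs j) n x) →
      ∃ ν : ProbabilityMeasure (Space A),
        (∀ j, αs j - ε < ∫ x, φs j x ∂(ν : Measure (Space A))) ∧
        (((n : ℝ)⁻¹ * (Real.log (∑ x ∈ D, Real.exp (birkhoff (shift A) φ n x - P * n)) - K) : ℝ) :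
          EReal) ≤ freeEnergy (shift A) φ P ν := by
  classical
  obtain ⟨Λ, hΛ⟩ := hirr
  set F : Set S := {s | s = a ∨ ∃ t ∈ Λ, s ∈ t}
  obtain ⟨M, hM0, hM⟩ := hG.exists_abs_le hc₀ (finite_eq_or_mem Λ a)
  set L : ℕ := 1 + 2 * Λ.sup List.length with hL
  have hLl : ∀ t ∈ Λ, t.length ≤ Λ.sup List.length := fun t ht => Finset.le_sup (f := List.length) ht
  choose Kj hKj0 hKj using fun j => (hφs j).1.abs_birkhoff_sub_le (hφs j).2 (δ := ε / 4) (by linarith)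
  choose C hC using fun j => (hφs j).2
  obtain ⟨N₁, hN₁⟩ := exists_nat_ge
    ((∑ j, |L * |αs j| + (Kj j + L * |C j|)|) / (ε / 4))
  rw [div_le_iff₀ (by linarith)] at hN₁
  have hlogc : 0 ≤ Real.log c₀ := Real.log_nonneg hc₀
  set q : ℝ := ((Λ ×ˢ Λ).card : ℝ) with hq
  refine ⟨Real.log c₀ + Real.log q + (2 * Real.log c₀ + L * M + L * |P|), max N₁ 1,
    le_max_right _ _, fun n hn D hDne hD hDα => ?_⟩
  have hn1 : 1 ≤ n := (le_max_right _ _).trans hn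
  have hnN : N₁ ≤ n := (le_max_left _ _).trans hn
  choose u hu r hr b hb hbx hbu hbr using fun x : Space A => exists_path_through hΛ a a x hn1
  set f : Space A → ℝ := fun x => Real.exp (birkhoff (shift A) φ n x - P * n) with hf
  have hf0 : ∀ x, 0 < f x := fun x => Real.exp_pos _
  set Z := ∑ x ∈ D, f x with hZ
  have hZ0 : 0 < Z := Finset.sum_pos (fun x _ => hf0 x) hDne
  have hne : (Λ ×ˢ Λ).Nonempty := by
    obtain ⟨x, _⟩ := hDne
    exact ⟨(u x, r x), Finset.mem_product.2 ⟨hu x, hr x⟩⟩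
  have hq1 : 1 ≤ q := by
    rw [hq]; exact_mod_cast hne.card_pos
  obtain ⟨⟨u₀, r₀⟩, hur, hle⟩ := Finset.exists_le_sum_fiber_of_maps_to_of_nsmul_le_sum
    (s := D) (t := Λ ×ˢ Λ) (f := fun x => (u x, r x)) (w := f) (b := Z / q)
    (fun x _ => Finset.mem_product.2 ⟨hu x, hr x⟩) hne (by
      rw [nsmul_eq_mul, ← hq, mul_div_cancel₀ _ (by linarith)])
  set D' := D.filter fun x => (u x, r x) = (u₀, r₀) with hD'
  set Z' := ∑ x ∈ D', f x with hZ'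
  have hZ'0 : 0 < Z' := lt_of_lt_of_le (by positivity) hle
  obtain ⟨hu₀, hr₀⟩ := Finset.mem_product.1 hur
  have hmem : ∀ d : D', d.1 ∈ D ∧ u d.1 = u₀ ∧ r d.1 = r₀ := fun d => by
    have := Finset.mem_filter.1 d.2
    exact ⟨this.1, by simpa using this.2⟩
  set k := 1 + u₀.length with hk
  set s := r₀.length with hs
  set m := k + n + s with hm
  have hmpos : 0 < m := by omega
  have hks : k + s ≤ L := by
    have h1 := hLl _ hu₀
    have h2 := hLl _ hr₀
    simp only at h1 h2
    omega
  have hksr : ((k : ℝ) + s) ≤ L := by exact_mod_cast hks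
  have hmr : (m : ℝ) = n + (k + s) := by rw [hm]; push_cast; ring
  have hb' : ∀ d : D', IsPath A a a m (b d.1) := fun d => by
    have := hb d.1
    rwa [(hmem d).2.1, (hmem d).2.2] at this
  have hbx' : ∀ (d : D'), ∀ i < n, b d.1 (k + i) = d.1.1 i := fun d i hi => by
    have := hbx d.1 i hi
    rwa [(hmem d).2.1] at this
  have hinj : ∀ d d' : D', (∀ i < m, b d.1 i = b d'.1 i) → d = d' := fun d d' h =>
    Subtype.ext (hD _ (hmem d).1 _ (hmem d').1 fun i hi => by
      rw [← hbx' d i hi, ← hbx' d' i hi]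
      exact h _ (by omega))
  set p : D' → ℝ := fun d => f d.1 / Z' with hp
  have hp0 : ∀ d, 0 < p d := fun d => div_pos (hf0 _) hZ'0
  have hp1 : ∑ d, p d = 1 := by
    rw [hp, ← Finset.sum_div, Finset.sum_coe_sort D' f, div_self hZ'0.ne']
  obtain ⟨ν, hinv, hent, hint⟩ := exists_invariant_measure hp0 hp1 hmpos hb' hinj
  -- symbols outside the central window belong to `F`
  have houter : ∀ (d : D') (y : Space A), (∀ i < m, y.1 i = b d.1 i) →
      (∀ i < k, y.1 i ∈ F) ∧ ∀ i < s, y.1 (k + n + i) ∈ F := by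
    intro d y hy
    constructor
    · intro i hi
      rw [hy i (by omega)]
      exact hbu d.1 i (by rw [(hmem d).2.1]; exact hi)
    · intro i hi
      rw [hy _ (by omega)]
      have := hbr d.1 i (by rw [(hmem d).2.2]; exact hi)
      rwa [(hmem d).2.1] at this
  have hinner : ∀ (d : D') (y : Space A), (∀ i < m, y.1 i = b d.1 i) →
      ∀ i < n, y.1 (k + i) = d.1.1 i := fun d y hy i hi => by
    rw [hy _ (by omega), hbx' d i hi]
  refine ⟨ν, fun j => ?_, ?_⟩
  · have hCC : ∀ y, |φs j y| ≤ |C j| := fun y => (hC j y).trans (le_abs_self _)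
    obtain ⟨-, h2⟩ := hint (φs j) (|C j|)
      (fun _ => n * αs j - (n * (ε / 4) + Kj j) - (k + s) * |C j|) (hφs j).1.continuous.measurable
      (fun y _ => hCC y) (fun d y hy => by
        refine le_trans ?_ (birkhoff_ge_of_block (x := d.1) (M := |C j|) (K := n * (ε / 4) + Kj j)
          (hinner d y hy) (fun z hz => ?_) (fun i _ => (abs_le.1 (hCC _)).1)
          (fun i _ => (abs_le.1 (hCC _)).1))
        · have := hDα _ (hmem d).1 j
          linarith
        · have := (abs_le.1 (hKj j n z d.1 hz)).1
          linarith)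
    refine lt_of_lt_of_le ?_ h2
    rw [← Finset.sum_mul, hp1, one_mul, inv_mul_eq_div, lt_div_iff₀ (by exact_mod_cast hmpos), hmr]
    have h3 : L * |αs j| + (Kj j + L * |C j|) ≤ n * (ε / 4) := by
      refine le_trans ?_ (hN₁.trans (mul_le_mul_of_nonneg_right (by exact_mod_cast hnN) (by linarith)))
      exact (le_abs_self _).trans (Finset.single_le_sum
        (f := fun j => |L * |αs j| + (Kj j + L * |C j|)|) (fun _ _ => abs_nonneg _) (Finset.mem_univ j))
    have hks0 : (0 : ℝ) ≤ k + s := by positivity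
    have h4 : (k + s) * |C j| ≤ L * |C j| := mul_le_mul_of_nonneg_right hksr (abs_nonneg _)
    have h5 : (k + s) * αs j ≤ L * |αs j| :=
      (mul_le_mul_of_nonneg_left (le_abs_self _) hks0).trans
        (mul_le_mul_of_nonneg_right hksr (abs_nonneg _))
    have h6 : 0 < (n : ℝ) * ε := mul_pos (by exact_mod_cast hn1) hε
    have h7 : 0 ≤ (k + s) * ε := mul_nonneg hks0 hε.le
    nlinarith
  · have hsym : {t : S | ∃ d : D', ∃ i < m, t = b d.1 i}.Finite := by
      refine ((Set.finite_univ (α := D')).prod (Set.finite_lt_nat m)).image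
        (fun e => b e.1.1 e.2) |>.subset ?_
      rintro _ ⟨d, i, hi, rfl⟩
      exact ⟨(d, i), ⟨mem_univ _, hi⟩, rfl⟩
    obtain ⟨C', -, hC'⟩ := hG.exists_abs_le hc₀ hsym
    obtain ⟨h1, h2⟩ := hint φ C'
      (fun d => birkhoff (shift A) φ n d.1 - 2 * Real.log c₀ - (k + s) * M) hφ
      (fun y hy => hC' y hy) (fun d y hy => by
        refine birkhoff_ge_of_block (hinner d y hy)
          (fun z hz => hG.birkhoff_sub_le hc₀ hn1 fun i hi => (hz i hi).symm)
          (fun i hi => (abs_le.1 (hM _ ?_)).1) (fun i hi => (abs_le.1 (hM _ ?_)).1)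
        · rw [shift_iterate_apply, zero_add]
          exact (houter d y hy).1 i hi
        · rw [shift_iterate_apply, zero_add]
          exact (houter d y hy).2 i hi)
    refine le_trans (EReal.coe_le_coe_iff.2 ?_) (le_freeEnergy hinv hent h1 h2)
    have hlogp : ∀ d : D', Real.negMulLog (p d) + p d *
        (birkhoff (shift A) φ n d.1 - 2 * Real.log c₀ - (k + s) * M)
        = p d * (Real.log Z' + P * n - 2 * Real.log c₀ - (k + s) * M) := fun d => by
      have : Real.log (p d) = birkhoff (shift A) φ n d.1 - P * n - Real.log Z' := by
        rw [hp, Real.log_div (hf0 _).ne' hZ'0.ne', hf, Real.log_exp]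
      rw [Real.negMulLog, this]
      ring
    have hmr0 : (0 : ℝ) < m := by exact_mod_cast hmpos
    have hnr0 : (0 : ℝ) < n := by exact_mod_cast hn1
    rw [← mul_add, ← Finset.sum_add_distrib, Finset.sum_congr rfl fun d _ => hlogp d,
      ← Finset.sum_mul, hp1, one_mul]
    have hlogZ' : Real.log Z - Real.log q ≤ Real.log Z' := by
      rw [← Real.log_div hZ0.ne' (by linarith)]
      exact Real.log_le_log (by positivity) hle
    have hlogZ : Real.log Z ≤ Real.log c₀ :=
      Real.log_le_log hZ0 (sum_exp_birkhoff_le hc₀ hG hn1 D hD)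
    have hlogq : 0 ≤ Real.log q := Real.log_nonneg hq1
    set K := Real.log c₀ + Real.log q + (2 * Real.log c₀ + L * M + L * |P|) with hK
    have hks0 : (0 : ℝ) ≤ k + s := by positivity
    have hkM : (k + s) * M ≤ L * M := mul_le_mul_of_nonneg_right hksr hM0
    have hkP : (k + s) * P ≤ L * |P| :=
      (mul_le_mul_of_nonneg_left (le_abs_self _) hks0).trans
        (mul_le_mul_of_nonneg_right hksr (abs_nonneg _))
    have hLM : 0 ≤ L * M := by positivity
    have hLP : 0 ≤ L * |P| := by positivity
    have hneg : Real.log Z - K ≤ 0 := by linarith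
    have hinvle : (m : ℝ)⁻¹ ≤ (n : ℝ)⁻¹ := inv_anti₀ hnr0 (by rw [hmr]; linarith)
    calc (n : ℝ)⁻¹ * (Real.log Z - K) ≤ (m : ℝ)⁻¹ * (Real.log Z - K) :=
          mul_le_mul_of_nonpos_right hinvle hneg
      _ ≤ (m : ℝ)⁻¹ * (Real.log Z' + P * n - 2 * Real.log c₀ - (k + s) * M - P * m) := by
          refine mul_le_mul_of_nonneg_left ?_ (by positivity)
          rw [hmr]
          linarith
      _ = _ := by
          rw [mul_sub _ _ (P * (m : ℝ))]
          field_simp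

end Construction

/-! ### Upper bounds -/

section UpperBound

theorem limsup_log_le {u : ℕ → ℝ≥0∞} {R : EReal}
    (h : ∀ r : ℝ, R ≤ r → ∃ (K : ℝ) (N : ℕ), ∀ n ≥ N, u n ≤ ENNReal.ofReal (Real.exp (n * r + K))) :
    atTop.limsup (fun n : ℕ => (((n : ℝ)⁻¹ : ℝ) : EReal) * ENNReal.log (u n)) ≤ R := by
  refine EReal.le_of_forall_lt_iff_le.1 fun z hz => ?_
  obtain ⟨r, hRr, hrz⟩ := EReal.lt_iff_exists_real_btwn.1 hz
  have hrz' : r < z := EReal.coe_lt_coe_iff.1 hrz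
  obtain ⟨K, N, hN⟩ := h r hRr.le
  obtain ⟨N', hN'⟩ := exists_nat_ge (K / (z - r))
  rw [div_le_iff₀ (by linarith)] at hN'
  refine limsup_le_of_le (h := ?_)
  filter_upwards [eventually_ge_atTop N, eventually_ge_atTop N', eventually_ge_atTop 1]
    with n h1 h2 h3
  have hn0 : (0 : ℝ) < n := by exact_mod_cast h3
  have hlog : ENNReal.log (u n) ≤ ((n * z : ℝ) : EReal) := by
    refine (ENNReal.log_le_log (hN n h1)).trans ?_
    rw [ENNReal.log_ofReal_of_pos (Real.exp_pos _), Real.log_exp, EReal.coe_le_coe_iff]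
    have : (N' : ℝ) * (z - r) ≤ n * (z - r) :=
      mul_le_mul_of_nonneg_right (by exact_mod_cast h2) (by linarith)
    linarith
  calc (((n : ℝ)⁻¹ : ℝ) : EReal) * ENNReal.log (u n)
      ≤ (((n : ℝ)⁻¹ : ℝ) : EReal) * ((n * z : ℝ) : EReal) :=
        mul_le_mul_of_nonneg_left hlog (EReal.coe_nonneg.2 (by positivity))
    _ = z := by rw [← EReal.coe_mul, inv_mul_cancel_left₀ hn0.ne']

/-- Every set of points contains exactly one representative for each of its initial words of
length `n`, chosen in some countable subset. -/
theorem exists_representatives {S : Type*} [Countable S] {A : S → S → Prop} (G : Set (Space A)) (n : ℕ) :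
    ∃ R ⊆ G, R.Countable ∧ (∀ x ∈ R, ∀ y ∈ R, (∀ i < n, x.1 i = y.1 i) → x = y) ∧
      G ⊆ ⋃ x ∈ R, cylinder A (word x n) := by
  let f : Space A → Fin n → S := fun x i => x.1 i
  obtain ⟨R, hRG, hR⟩ := (Set.surjOn_image f G).exists_bijOn_subset
  refine ⟨R, hRG, Set.MapsTo.countable_of_injOn (hR.mapsTo) hR.injOn (Set.to_countable _),
    fun x hx y hy h => hR.injOn hx hy (funext fun i => h i i.2), fun y hy => ?_⟩
  obtain ⟨x, hx, hxy⟩ := hR.surjOn (mem_image_of_mem f hy)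
  exact mem_iUnion₂.2 ⟨x, hx, mem_cylinder_word.2 fun i hi => (congrFun hxy ⟨i, hi⟩).symm⟩

variable {S : Type*} [TopologicalSpace S] {A : S → S → Prop}

theorem IsGibbsWith.measure_le_tsum {φ : Space A → ℝ} {μ : Measure (Space A)}
    [IsProbabilityMeasure μ] {c₀ P : ℝ} (hc₀ : 1 ≤ c₀) (hG : IsGibbsWith A φ μ c₀ P) {n : ℕ}
    (hn : 1 ≤ n) {G R : Set (Space A)} (hR : R.Countable)
    (hGR : G ⊆ ⋃ x ∈ R, cylinder A (word x n)) :
    μ G ≤ ENNReal.ofReal c₀ *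
      ∑' x : R, ENNReal.ofReal (Real.exp (birkhoff (shift A) φ n x - P * n)) := by
  rw [← ENNReal.tsum_mul_left]
  refine (measure_mono hGR).trans ((measure_biUnion_le μ hR _).trans (ENNReal.tsum_le_tsum fun x => ?_))
  rw [← ENNReal.ofReal_mul (by linarith), ← ENNReal.ofReal_toReal (measure_ne_top μ _),
    sub_eq_neg_add]
  exact ENNReal.ofReal_le_ofReal (hG n hn x).2

theorem weightedDistr_le {φ : Space A → ℝ} {P : ℝ} {n : ℕ} {C : Set (Space A)} {V : Set (ProbabilityMeasure (Space A))}
    (hV : MeasurableSet V) {K t : ℝ}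
    (hK : ENNReal.ofReal (Real.exp (P * n - K)) ≤ Zfn (shift A) φ n C)
    (ht : ∑' x : ↥(C ∩ {x | empirical (shift A) x n ∈ V}),
      ENNReal.ofReal (Real.exp (birkhoff (shift A) φ n x - P * n)) ≤ ENNReal.ofReal (Real.exp t)) :
    weightedDistr (shift A) φ n C V ≤ ENNReal.ofReal (Real.exp (t + K)) := by
  set w : Space A → ℝ≥0∞ := fun x => ENNReal.ofReal (Real.exp (birkhoff (shift A) φ n x - P * n))
    with hw
  set G : Set (Space A) := {x | empirical (shift A) x n ∈ V} with hGdef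
  have hnum : Measure.sum (fun x : C => ENNReal.ofReal (Real.exp (birkhoff (shift A) φ n x)) •
      Measure.dirac (empirical (shift A) (x : Space A) n)) V
      = ENNReal.ofReal (Real.exp (P * n)) * ∑' x : ↥(C ∩ G), w x := by
    rw [Measure.sum_apply _ hV, ← ENNReal.tsum_mul_left, tsum_subtype C fun x =>
      (ENNReal.ofReal (Real.exp (birkhoff (shift A) φ n x)) •
        Measure.dirac (empirical (shift A) x n)) V,
      tsum_subtype (C ∩ G) fun x => ENNReal.ofReal (Real.exp (P * n)) * w x]
    refine tsum_congr fun x => ?_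
    rw [← Set.indicator_indicator]
    refine congrArg (fun g : Space A → ℝ≥0∞ => C.indicator g x) (funext fun x => ?_)
    have hexp : ENNReal.ofReal (Real.exp (birkhoff (shift A) φ n x))
        = ENNReal.ofReal (Real.exp (P * n)) * w x := by
      rw [hw, ← ENNReal.ofReal_mul (Real.exp_pos _).le, ← Real.exp_add, add_sub_cancel]
    rw [Measure.smul_apply, Measure.dirac_apply' _ hV, hexp]
    by_cases hx : empirical (shift A) x n ∈ V <;> simp [hx, hGdef]
  rw [weightedDistr, Measure.smul_apply, hnum, smul_eq_mul]
  calc (Zfn (shift A) φ n C)⁻¹ * (ENNReal.ofReal (Real.exp (P * n)) * ∑' x : ↥(C ∩ G), w x)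
      ≤ (ENNReal.ofReal (Real.exp (P * n - K)))⁻¹ *
        (ENNReal.ofReal (Real.exp (P * n)) * ENNReal.ofReal (Real.exp t)) := by gcongr
    _ = ENNReal.ofReal (Real.exp (t + K)) := by
        rw [← ENNReal.ofReal_inv_of_pos (Real.exp_pos _), ← Real.exp_neg,
          ← ENNReal.ofReal_mul (Real.exp_pos _).le, ← ENNReal.ofReal_mul (Real.exp_pos _).le,
          ← Real.exp_add, ← Real.exp_add]
        congr 2
        ring

theorem exists_le_Zfn [Countable S] {φ : Space A → ℝ} {μ : Measure (Space A)}
    [IsProbabilityMeasure μ] {c₀ P : ℝ} {Λ : Finset (List S)} {N : ℕ} (hN : ∀ t ∈ Λ, t.length = N)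
    (hΛ : ∀ v w : List S, Admissible A v → Admissible A w → ∃ t ∈ Λ, Admissible A (v ++ t ++ w))
    (hc₀ : 1 ≤ c₀) (hG : IsGibbsWith A φ μ c₀ P) {a e : S} {C : ℕ → Set (Space A)}
    (hC : ∀ m > 0, ∀ b : ℕ → S, IsPath A a e m b → ∃ z ∈ C m, ∀ i < m, z.1 i = b i) :
    ∃ (K : ℝ) (N₀ : ℕ), ∀ n ≥ N₀,
      ENNReal.ofReal (Real.exp (P * n - K)) ≤ Zfn (shift A) φ n (C n) := by
  classical
  obtain ⟨M, hM0, hM⟩ := hG.exists_abs_le hc₀ (finite_eq_or_mem Λ a)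
  set k : ℕ := 1 + N with hk
  refine ⟨3 * Real.log c₀ + (k + N) * (M + P), k + N + 1, fun n hn => ?_⟩
  obtain ⟨q, rfl, hq⟩ : ∃ q, n = k + q + N ∧ 0 < q := ⟨n - k - N, by omega, by omega⟩
  have hz : ∀ x : Space A, ∃ z ∈ C (k + q + N), (∀ i < q, z.1 (k + i) = x.1 i) ∧
      birkhoff (shift A) φ q x - 2 * Real.log c₀ - (k + N) * M
        ≤ birkhoff (shift A) φ (k + q + N) z := fun x => by
    obtain ⟨u, hu, v, hv, b, hb, hbx, hbu, hbv⟩ := exists_path_through hΛ a e x hq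
    rw [hN u hu, hN v hv] at hb
    rw [hN u hu] at hbx hbu hbv
    rw [hN v hv] at hbv
    obtain ⟨z, hzC, hzb⟩ := hC _ (by omega) b hb
    have hzx : ∀ i < q, z.1 (k + i) = x.1 i := fun i hi => by
      rw [hzb _ (by omega), hbx i hi]
    refine ⟨z, hzC, hzx, birkhoff_ge_of_block hzx
      (fun w hw => hG.birkhoff_sub_le hc₀ hq fun i hi => (hw i hi).symm)
      (fun i hi => (abs_le.1 (hM _ ?_)).1) (fun i hi => (abs_le.1 (hM _ ?_)).1)⟩
    · rw [shift_iterate_apply, zero_add, hzb _ (by omega)]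
      exact hbu i hi
    · rw [shift_iterate_apply, zero_add, hzb _ (by omega)]
      exact hbv i hi
  choose z hzC hzx hzφ using hz
  obtain ⟨R, -, hR, hinj, hcov⟩ := exists_representatives (univ : Set (Space A)) q
  have h1 := hG.measure_le_tsum hc₀ hq hR hcov
  rw [measure_univ] at h1
  have hg : Function.Injective fun x : R => (⟨z x, hzC x⟩ : C (k + q + N)) := fun x y hxy =>
    Subtype.ext (hinj _ x.2 _ y.2 fun i hi => by
      rw [← hzx x.1 i hi, ← hzx y.1 i hi, show z x.1 = z y.1 from congrArg Subtype.val hxy])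
  calc ENNReal.ofReal (Real.exp (P * (k + q + N : ℕ) - (3 * Real.log c₀ + (k + N) * (M + P))))
      ≤ ENNReal.ofReal (Real.exp (P * (k + q + N : ℕ) - (3 * Real.log c₀ + (k + N) * (M + P)))) *
        (ENNReal.ofReal c₀ *
          ∑' x : R, ENNReal.ofReal (Real.exp (birkhoff (shift A) φ q x - P * q))) :=
        le_mul_of_one_le_right' h1
    _ ≤ ∑' x : R, ENNReal.ofReal (Real.exp (birkhoff (shift A) φ (k + q + N) (z x))) := by
        rw [← mul_assoc, ← ENNReal.tsum_mul_left]
        refine ENNReal.tsum_le_tsum fun x => ?_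
        rw [← ENNReal.ofReal_mul (Real.exp_pos _).le, ← ENNReal.ofReal_mul (by positivity)]
        refine ENNReal.ofReal_le_ofReal ?_
        nth_rewrite 2 [← Real.exp_log (show 0 < c₀ by linarith)]
        rw [← Real.exp_add, ← Real.exp_add, Real.exp_le_exp]
        have := hzφ x
        push_cast
        linarith
    _ ≤ Zfn (shift A) φ (k + q + N) (C (k + q + N)) :=
        ENNReal.tsum_comp_le_tsum_of_injective hg
          fun w : C (k + q + N) => ENNReal.ofReal (Real.exp (birkhoff (shift A) φ (k + q + N) w))

theorem integral_empirical {ψ : Space A → ℝ} (hψ : Continuous ψ) {n : ℕ} (hn : 1 ≤ n)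
    (x : Space A) :
    ∫ z, ψ z ∂(empirical (shift A) x n : Measure (Space A))
      = (n : ℝ)⁻¹ * birkhoff (shift A) ψ n x := by
  have hd : ∀ z, ∫ w, ψ w ∂(Measure.dirac z) = ψ z := fun z =>
    integral_dirac' _ _ hψ.measurable.stronglyMeasurable
  have hi : ∀ z, Integrable ψ (Measure.dirac z) := fun z =>
    ⟨hψ.measurable.aestronglyMeasurable, by
      rw [HasFiniteIntegral, lintegral_dirac' _ hψ.measurable.enorm]; exact enorm_lt_top⟩
  simp only [empirical, max_eq_left hn, ProbabilityMeasure.coe_mk]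
  rw [integral_smul_measure, integral_finsetSum_measure fun i _ => hi _]
  simp [hd, birkhoff]

variable [DiscreteTopology S]

theorem measurableSet_le_integral {l : ℕ} {φs : Fin l → Space A → ℝ}
    (hφs : ∀ j, UnifCont A (φs j) ∧ Bdd A (φs j)) (αs : Fin l → ℝ) :
    MeasurableSet {μ : ProbabilityMeasure (Space A) |
      ∀ j, αs j ≤ ∫ x, φs j x ∂(μ : Measure (Space A))} := by
  have : BorelSpace (ProbabilityMeasure (Space A)) := ⟨rfl⟩
  have hc : ∀ j, IsClosed {μ : ProbabilityMeasure (Space A) |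
      αs j ≤ ∫ x, φs j x ∂(μ : Measure (Space A))} := fun j => by
    obtain ⟨C, hC⟩ := (hφs j).2
    exact isClosed_le continuous_const
      (ProbabilityMeasure.continuous_integral_boundedContinuousFunction
        (BoundedContinuousFunction.ofNormedAddCommGroup (φs j) (hφs j).1.continuous C hC))
  have := (isClosed_iInter hc).measurableSet
  convert this using 1
  ext; simp

theorem mul_le_birkhoff_of_empirical_mem {l : ℕ} {φs : Fin l → Space A → ℝ}
    (hφs : ∀ j, UnifCont A (φs j) ∧ Bdd A (φs j)) {αs : Fin l → ℝ} {n : ℕ} (hn : 1 ≤ n)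
    {x : Space A} (hx : empirical (shift A) x n ∈ {μ : ProbabilityMeasure (Space A) |
      ∀ j, αs j ≤ ∫ x, φs j x ∂(μ : Measure (Space A))}) (j : Fin l) :
    n * αs j ≤ birkhoff (shift A) (φs j) n x := by
  have h := hx j
  have hn0 : (0 : ℝ) < n := by exact_mod_cast hn
  rwa [integral_empirical (hφs j).1.continuous hn, le_inv_mul_iff₀ hn0] at h

section

variable [Countable S] {φ : Space A → ℝ} {μ : Measure (Space A)} [IsProbabilityMeasure μ]
  {c₀ P : ℝ} {l : ℕ} {φs : Fin l → Space A → ℝ}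

theorem exists_tsum_le (hirr : FinitelyIrreducible A) (hφ : Measurable φ) (hc₀ : 1 ≤ c₀)
    (hG : IsGibbsWith A φ μ c₀ P) (hφs : ∀ j, UnifCont A (φs j) ∧ Bdd A (φs j)) (αs : Fin l → ℝ)
    {ε : ℝ} (hε : 0 < ε) (a : S) {r : ℝ}
    (hr : ⨆ ν ∈ {ν : ProbabilityMeasure (Space A) |
      ∀ j, αs j - ε < ∫ x, φs j x ∂(ν : Measure (Space A))}, freeEnergy (shift A) φ P ν ≤ r) :
    ∃ (K : ℝ) (N₀ : ℕ), 1 ≤ N₀ ∧ ∀ n ≥ N₀, ∀ G : Set (Space A),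
      (∀ x ∈ G, ∀ y ∈ G, (∀ i < n, x.1 i = y.1 i) → x = y) →
      (∀ x ∈ G, ∀ j, n * αs j ≤ birkhoff (shift A) (φs j) n x) →
      ∑' x : G, ENNReal.ofReal (Real.exp (birkhoff (shift A) φ n x - P * n))
        ≤ ENNReal.ofReal (Real.exp (n * r + K)) := by
  classical
  obtain ⟨K, N₀, hN₀, h⟩ := exists_freeEnergy_ge hirr hφ hc₀ hG hφs αs hε a
  refine ⟨K, N₀, hN₀, fun n hn G hinj hα => ?_⟩
  have hn0 : (0 : ℝ) < n := by exact_mod_cast hN₀.trans hn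
  rw [ENNReal.tsum_eq_iSup_sum]
  refine iSup_le fun D => ?_
  rw [← ENNReal.ofReal_sum_of_nonneg fun _ _ => (Real.exp_pos _).le]
  refine ENNReal.ofReal_le_ofReal ?_
  rcases D.eq_empty_or_nonempty with rfl | hD
  · simpa using (Real.exp_pos _).le
  set E : Finset (Space A) := D.map (Function.Embedding.subtype _) with hE
  have hEG : ∀ x ∈ E, x ∈ G := fun x hx => by
    obtain ⟨y, -, rfl⟩ := Finset.mem_map.1 hx
    exact y.2
  obtain ⟨ν, hν, hle⟩ := h n hn E (hD.map) (fun x hx y hy => hinj x (hEG x hx) y (hEG y hy))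
    (fun x hx => hα x (hEG x hx))
  have h1 := EReal.coe_le_coe_iff.1 (hle.trans ((le_iSup₂ (f := fun (ν : ProbabilityMeasure (Space A))
    (_ : ν ∈ {ν : ProbabilityMeasure (Space A) |
      ∀ j, αs j - ε < ∫ x, φs j x ∂(ν : Measure (Space A))}) => freeEnergy (shift A) φ P ν)
    ν hν).trans hr))
  rw [inv_mul_le_iff₀ hn0, hE, Finset.sum_map] at h1
  have hpos : 0 < ∑ x ∈ D, Real.exp (birkhoff (shift A) φ n x - P * n) :=
    Finset.sum_pos (fun _ _ => Real.exp_pos _) hD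
  rw [← Real.log_le_iff_le_exp hpos]
  simp only [Function.Embedding.coe_subtype] at h1
  linarith

theorem limsup_empDistr_le (hirr : FinitelyIrreducible A) (hφ : Measurable φ) (hc₀ : 1 ≤ c₀)
    (hG : IsGibbsWith A φ μ c₀ P) (hφs : ∀ j, UnifCont A (φs j) ∧ Bdd A (φs j)) (αs : Fin l → ℝ)
    {ε : ℝ} (hε : 0 < ε) (a : S) :
    atTop.limsup (fun n : ℕ => (((n : ℝ)⁻¹ : ℝ) : EReal) *
        ENNReal.log (empDistr (shift A) μ n {ν : ProbabilityMeasure (Space A) |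
          ∀ j, αs j ≤ ∫ x, φs j x ∂(ν : Measure (Space A))})) ≤
      ⨆ ν ∈ {ν : ProbabilityMeasure (Space A) |
        ∀ j, αs j - ε < ∫ x, φs j x ∂(ν : Measure (Space A))}, freeEnergy (shift A) φ P ν := by
  refine limsup_log_le fun r hr => ?_
  obtain ⟨K, N₀, hN₀, h⟩ := exists_tsum_le hirr hφ hc₀ hG hφs αs hε a hr
  refine ⟨K + Real.log c₀, N₀, fun n hn => ?_⟩
  have hn1 : 1 ≤ n := hN₀.trans hn
  by_cases hm : AEMeasurable (fun x => empirical (shift A) x n) μ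
  swap
  · simp [empDistr, Measure.map_of_not_aemeasurable hm]
  rw [empDistr, Measure.map_apply_of_aemeasurable hm (measurableSet_le_integral hφs αs)]
  obtain ⟨R, hRG, hR, hinj, hcov⟩ := exists_representatives ((fun x => empirical (shift A) x n) ⁻¹'
    {ν : ProbabilityMeasure (Space A) | ∀ j, αs j ≤ ∫ x, φs j x ∂(ν : Measure (Space A))}) n
  refine (hG.measure_le_tsum hc₀ hn1 hR hcov).trans ?_
  refine (mul_le_mul_right (h n hn R hinj fun x hx =>
    mul_le_birkhoff_of_empirical_mem hφs hn1 (hRG hx)) _).trans_eq ?_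
  rw [← ENNReal.ofReal_mul (by linarith), ← add_assoc, Real.exp_add _ (Real.log c₀),
    Real.exp_log (by linarith), mul_comm]

theorem limsup_weightedDistr_le (hprim : FinitelyPrimitive A) (hφ : Measurable φ) (hc₀ : 1 ≤ c₀)
    (hG : IsGibbsWith A φ μ c₀ P) (hφs : ∀ j, UnifCont A (φs j) ∧ Bdd A (φs j)) (αs : Fin l → ℝ)
    {ε : ℝ} (hε : 0 < ε) {a e : S} {C : ℕ → Set (Space A)}
    (hC : ∀ m > 0, ∀ b : ℕ → S, IsPath A a e m b → ∃ z ∈ C m, ∀ i < m, z.1 i = b i)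
    (hinj : ∀ n > 0, ∀ x ∈ C n, ∀ y ∈ C n, (∀ i < n, x.1 i = y.1 i) → x = y) :
    atTop.limsup (fun n : ℕ => (((n : ℝ)⁻¹ : ℝ) : EReal) *
        ENNReal.log (weightedDistr (shift A) φ n (C n) {ν : ProbabilityMeasure (Space A) |
          ∀ j, αs j ≤ ∫ x, φs j x ∂(ν : Measure (Space A))})) ≤
      ⨆ ν ∈ {ν : ProbabilityMeasure (Space A) |
        ∀ j, αs j - ε < ∫ x, φs j x ∂(ν : Measure (Space A))}, freeEnergy (shift A) φ P ν := by
  obtain ⟨Λ, ⟨N, hN⟩, hΛ⟩ := hprim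
  obtain ⟨K, N₁, hK⟩ := exists_le_Zfn hN hΛ hc₀ hG hC
  refine limsup_log_le fun r hr => ?_
  obtain ⟨K', N₀, hN₀, h⟩ := exists_tsum_le ⟨Λ, hΛ⟩ hφ hc₀ hG hφs αs hε a hr
  refine ⟨K' + K, max N₀ N₁, fun n hn => ?_⟩
  have hn0 : N₀ ≤ n := (le_max_left _ _).trans hn
  rw [← add_assoc]
  exact weightedDistr_le (measurableSet_le_integral hφs αs) (hK n ((le_max_right _ _).trans hn))
    (h n hn0 _ (fun x hx y hy => hinj n (hN₀.trans hn0) x hx.1 y hy.1) fun x hx =>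
      mul_le_birkhoff_of_empirical_mem hφs (hN₀.trans hn0) hx.2)

end

end UpperBound

section Points

variable {S : Type*} {A : S → S → Prop}

theorem mem_cylinder_singleton {x : Space A} {a : S} : x ∈ cylinder A [a] ↔ x.1 0 = a := by
  simp [cylinder]

theorem eq_of_mem_perSet {n : ℕ} (hn : 0 < n) {x y : Space A} (hx : x ∈ perSet (shift A) n)
    (hy : y ∈ perSet (shift A) n) (h : ∀ i < n, x.1 i = y.1 i) : x = y := by
  have hstep : ∀ z ∈ perSet (shift A) n, ∀ k, z.1 (k + n) = z.1 k := fun z hz k => by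
    rw [← shift_iterate_apply, show (shift A)^[n] z = z from hz]
  refine Subtype.ext (funext fun k => ?_)
  induction k using Nat.strong_induction_on with
  | _ k ih =>
    rcases lt_or_ge k n with hk | hk
    · exact h k hk
    · obtain ⟨i, rfl⟩ := Nat.exists_eq_add_of_le' hk
      rw [hstep x hx, hstep y hy, ih i (by omega)]

theorem eq_of_mem_preimSet {n : ℕ} {w x y : Space A} (hx : x ∈ preimSet (shift A) n w)
    (hy : y ∈ preimSet (shift A) n w) (h : ∀ i < n, x.1 i = y.1 i) : x = y := by
  refine Subtype.ext (funext fun k => ?_)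
  rcases lt_or_ge k n with hk | hk
  · exact h k hk
  · obtain ⟨i, rfl⟩ := Nat.exists_eq_add_of_le' hk
    rw [← shift_iterate_apply, ← shift_iterate_apply,
      show (shift A)^[n] x = w from hx, show (shift A)^[n] y = w from hy]

theorem exists_mem_perSet {a : S} {m : ℕ} (hm : 0 < m) {b : ℕ → S} (hb : IsPath A a a m b) :
    ∃ z ∈ cylinder A [a] ∩ perSet (shift A) m, ∀ i < m, z.1 i = b i := by
  have happ : ∀ i < m, (concat (ι := Unit) hm (fun _ => hb) fun _ => ()).1 i = b i :=
    fun i hi => concat_apply_of_lt _ _ _ hi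
  exact ⟨_, ⟨mem_cylinder_singleton.2 ((happ 0 hm).trans hb.1), shift_iterate_concat hm _ _⟩, happ⟩

theorem exists_mem_preimSet {a : S} {y : Space A} {m : ℕ} (hm : 0 < m) {b : ℕ → S}
    (hb : IsPath A a (y.1 0) m b) :
    ∃ z ∈ cylinder A [a] ∩ preimSet (shift A) m y, ∀ i < m, z.1 i = b i := by
  have happ : ∀ i < m, (prepend hb).1 i = b i := fun i hi => by simp [prepend, hi]
  exact ⟨_, ⟨mem_cylinder_singleton.2 ((happ 0 hm).trans hb.1), shift_iterate_prepend hb⟩, happ⟩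

end Points

end CMS

open CMS in
/-- **Key large deviations upper bound.** For a finitely irreducible countable Markov shift
with a Gibbs state, bounded uniformly continuous `φ_1, …, φ_l` and reals `α_j`, for every
`ε > 0`, `limsup (1/n) log ξ_n(V̄{φ_j,α_j}) ≤ sup {F(μ) : μ ∈ V{φ_j, α_j - ε}}`; if the shift
is finitely primitive the same holds for `η_n`, `η_{a,n}`, `ζ_{y,n}` and `ζ_{a,y,n}`. -/
theorem key_upper_bound {S : Type*} [Countable S] [TopologicalSpace S] [DiscreteTopology S]
    (A : S → S → Prop) (hA : NoZeroRowCol A) (hirr : FinitelyIrreducible A)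
    (φ : Space A → ℝ) (hφ : Measurable φ)
    (μφ : ProbabilityMeasure (Space A)) (c₀ P : ℝ) (hc₀ : 1 ≤ c₀)
    (hGibbs : IsGibbsWith A φ (μφ : Measure (Space A)) c₀ P)
    (l : ℕ) (hl : 1 ≤ l) (φs : Fin l → Space A → ℝ)
    (hφs : ∀ j, UnifCont A (φs j) ∧ Bdd A (φs j)) (αs : Fin l → ℝ)
    (ε : ℝ) (hε : 0 < ε) :
    (atTop.limsup (fun n : ℕ => (((n : ℝ)⁻¹ : ℝ) : EReal) *
        ENNReal.log (empDistr (shift A) (μφ : Measure (Space A)) n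
          {μ : ProbabilityMeasure (Space A) |
            ∀ j, αs j ≤ ∫ x, φs j x ∂(μ : Measure (Space A))})) ≤
      ⨆ μ ∈ {μ : ProbabilityMeasure (Space A) |
          ∀ j, αs j - ε < ∫ x, φs j x ∂(μ : Measure (Space A))},
        freeEnergy (shift A) φ P μ) ∧
    (FinitelyPrimitive A → ∀ a : S, ∀ y : Space A,
      ∀ C ∈ ({perSet (shift A), fun n => cylinder A [a] ∩ perSet (shift A) n,
          fun n => preimSet (shift A) n y,
          fun n => cylinder A [a] ∩ preimSet (shift A) n y} :
            Set (ℕ → Set (Space A))),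
        atTop.limsup (fun n : ℕ => (((n : ℝ)⁻¹ : ℝ) : EReal) *
            ENNReal.log (weightedDistr (shift A) φ n (C n)
              {μ : ProbabilityMeasure (Space A) |
                ∀ j, αs j ≤ ∫ x, φs j x ∂(μ : Measure (Space A))})) ≤
          ⨆ μ ∈ {μ : ProbabilityMeasure (Space A) |
              ∀ j, αs j - ε < ∫ x, φs j x ∂(μ : Measure (Space A))},
            freeEnergy (shift A) φ P μ) := by
  obtain ⟨x₀⟩ : Nonempty (Space A) := (μφ : Measure (Space A)).nonempty_of_neZero
  refine ⟨limsup_empDistr_le hirr hφ hc₀ hGibbs hφs αs hε (x₀.1 0), fun hprim a y C hC => ?_⟩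
  rcases hC with rfl | rfl | rfl | rfl
  · refine limsup_weightedDistr_le hprim hφ hc₀ hGibbs hφs αs hε (a := a) (e := a)
      (fun m hm b hb => ?_) fun n hn x hx y hy => eq_of_mem_perSet hn hx hy
    obtain ⟨z, hz, h⟩ := exists_mem_perSet hm hb
    exact ⟨z, hz.2, h⟩
  · exact limsup_weightedDistr_le hprim hφ hc₀ hGibbs hφs αs hε (a := a) (e := a)
      (fun m hm b hb => exists_mem_perSet hm hb)
      fun n hn x hx y hy => eq_of_mem_perSet hn hx.2 hy.2
  · refine limsup_weightedDistr_le hprim hφ hc₀ hGibbs hφs αs hε (a := a) (e := y.1 0)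
      (fun m hm b hb => ?_) fun n hn x hx y hy => eq_of_mem_preimSet hx hy
    obtain ⟨z, hz, h⟩ := exists_mem_preimSet hm hb
    exact ⟨z, hz.2, h⟩
  · exact limsup_weightedDistr_le hprim hφ hc₀ hGibbs hφs αs hε (a := a) (e := y.1 0)
      (fun m hm b hb => exists_mem_preimSet hm hb)
      fun n hn x hx y hy => eq_of_mem_preimSet hx.2 hy.2
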